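/- arXiv:1512.07338 — 2 statements merged into one kernel-verified Lean document; each statement's English description precedes it below -/
import Mathlib

section
/- Any algorithm that solves the FC-problem can be used to solve the FF-problem: if there exists an FC-algorithm in w weighings for N coins, then there exists an FF-algorithm in w weighings for N coins. -/
/-- An adaptive strategy for balance weighings on `N` coins: a ternary decision
tree.  At a `weigh A B` node the sets `A` and `B` are placed on the two pans,
and the strategy branches on the outcome (`.lt`: left pan lighter, `.eq`:
balance, `.gt`: right pan lighter).  A leaf `output S` outputs the set `S` of
coins. -/
inductive FCTree (N : ℕ) : Type
  | output (S : Finset (Fin N)) : FCTree N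
  | weigh (A B : Finset (Fin N)) (child : Ordering → FCTree N) : FCTree N

namespace FCTree

/-- The depth (number of weighings in the worst case) of a strategy. -/
def depth {N : ℕ} : FCTree N → ℕ
  | output _ => 0
  | weigh _ _ child =>
      1 + max (depth (child .lt)) (max (depth (child .eq)) (depth (child .gt)))

/-- A strategy is well-formed if in every weighing the two pans are disjoint. -/
def WF {N : ℕ} : FCTree N → Prop
  | output _ => True
  | weigh A B child => Disjoint A B ∧ ∀ o, WF (child o)

end FCTree

/-- Weight of coin `x` when `f` is the fake coin, `c` is the chameleon, and the
chameleon chooses to weigh as a fake coin iff `b = true`.  Real coins weigh `1`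
and the (lighter) fake coin weighs `0`. -/
def coinWeight {N : ℕ} (f c : Fin N) (b : Bool) (x : Fin N) : ℕ :=
  if x = f then 0 else if x = c ∧ b = true then 0 else 1

/-- The outcome of weighing pan `A` against pan `B`, with fake `f`, chameleon
`c`, and chameleon choice `b`. -/
def weighOutcome {N : ℕ} (f c : Fin N) (b : Bool) (A B : Finset (Fin N)) : Ordering :=
  compare (∑ x ∈ A, coinWeight f c b x) (∑ x ∈ B, coinWeight f c b x)

/-- `Reaches f c t S` holds if, with fake coin `f` and chameleon `c`, some
sequence of choices by the chameleon (one choice before each weighing,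
independently) leads the strategy `t` to output the set `S`. -/
inductive Reaches {N : ℕ} (f c : Fin N) : FCTree N → Finset (Fin N) → Prop
  | output (S : Finset (Fin N)) : Reaches f c (.output S) S
  | weigh (A B : Finset (Fin N)) (child : Ordering → FCTree N) (b : Bool)
      (S : Finset (Fin N)) :
      Reaches f c (child (weighOutcome f c b A B)) S →
      Reaches f c (.weigh A B child) S

/-- `t` is an FC-solution for `N` coins in `w` weighings: a well-formed strategy
of depth at most `w` which, for every placement of the fake coin and the
chameleon and every sequence of choices by the chameleon, outputs a set of at
most 2 coins containing the fake coin. -/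
def IsFCSolution {N : ℕ} (t : FCTree N) (w : ℕ) : Prop :=
  t.WF ∧ t.depth ≤ w ∧
    ∀ f c : Fin N, f ≠ c → ∀ S, Reaches f c t S → S.card ≤ 2 ∧ f ∈ S

/-- There is an FC-algorithm in `w` weighings for `N` coins. -/
def FCAlgorithm (N w : ℕ) : Prop := ∃ t : FCTree N, IsFCSolution t w

/-- `FC N` is the least number of weighings `w` for which an FC-algorithm in
`w` weighings for `N` coins exists. -/
noncomputable def FC (N : ℕ) : ℕ := sInf {w | FCAlgorithm N w}

/-- Weight of coin `x` in the FF-problem with fake coins `f₁` and `f₂`. -/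
def ffWeight {N : ℕ} (f₁ f₂ x : Fin N) : ℕ := if x = f₁ ∨ x = f₂ then 0 else 1

/-- The (deterministic) run of a strategy in the FF-problem with fake coins
`f₁` and `f₂`; it returns the output set. -/
def ffRun {N : ℕ} (f₁ f₂ : Fin N) : FCTree N → Finset (Fin N)
  | .output S => S
  | .weigh A B child =>
      ffRun f₁ f₂
        (child (compare (∑ x ∈ A, ffWeight f₁ f₂ x) (∑ x ∈ B, ffWeight f₁ f₂ x)))

/-- There is an FF-algorithm in `w` weighings for `N` coins: a well-formed
strategy of depth at most `w` that identifies both fake coins for every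
placement of the two fake coins. -/
def FFAlgorithm (N w : ℕ) : Prop :=
  ∃ t : FCTree N, t.WF ∧ t.depth ≤ w ∧
    ∀ f₁ f₂ : Fin N, f₁ ≠ f₂ → ffRun f₁ f₂ t = {f₁, f₂}

/-- The group (of three coins) to which a coin of the scaled problem belongs. -/
def coinGroup {N : ℕ} (x : Fin (3 * N)) : Fin N :=
  ⟨x.val / 3, by have := x.isLt; omega⟩

/-- The set of coins of the scaled problem whose group lies in `A`. -/
def expandPan {N : ℕ} (A : Finset (Fin N)) : Finset (Fin (3 * N)) :=
  Finset.univ.filter (fun x => coinGroup x ∈ A)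

/-- The scaling of a strategy, extended at the leaves: every coin is replaced
by a group of three coins, every weighing is performed on the corresponding
groups, and every leaf `output S` is replaced by the strategy `ext S`. -/
def scaleExtend {N : ℕ} (ext : Finset (Fin N) → FCTree (3 * N)) :
    FCTree N → FCTree (3 * N)
  | .output S => ext S
  | .weigh A B child =>
      .weigh (expandPan A) (expandPan B) (fun o => scaleExtend ext (child o))

/-- A `(w,N)`-solution `t` is scalable if its scaling can be extended by (at
most) two further weighings at each leaf to a `(w+2, 3N)`-solution. -/
def IsScalable {N : ℕ} (t : FCTree N) (w : ℕ) : Prop :=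
  ∃ ext : Finset (Fin N) → FCTree (3 * N),
    (∀ S, (ext S).WF ∧ (ext S).depth ≤ 2) ∧
    IsFCSolution (scaleExtend ext t) (w + 2)

/-- A chameleon that always weighs as a fake coin weighs like a second fake coin. -/
theorem coinWeight_true {N : ℕ} (f c x : Fin N) : coinWeight f c true x = ffWeight f c x := by
  by_cases hf : x = f <;> by_cases hc : x = c <;> simp [coinWeight, ffWeight, hf, hc]

theorem ffWeight_comm {N : ℕ} (f₁ f₂ : Fin N) : ffWeight f₁ f₂ = ffWeight f₂ f₁ := by
  funext x
  simp only [ffWeight, or_comm]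

theorem ffRun_comm {N : ℕ} (f₁ f₂ : Fin N) (t : FCTree N) : ffRun f₁ f₂ t = ffRun f₂ f₁ t := by
  induction t with
  | output S => rfl
  | weigh A B child ih => simp only [ffRun, ffWeight_comm f₁ f₂, ih]

/-- The output for two fake coins is reached in the FC-problem when the chameleon always weighs
as a fake coin. -/
theorem reaches_ffRun {N : ℕ} (f c : Fin N) (t : FCTree N) : Reaches f c t (ffRun f c t) := by
  induction t with
  | output S => exact .output S
  | weigh A B child ih =>
    refine .weigh A B child true _ ?_
    simpa only [weighOutcome, coinWeight_true, ffRun] using ih _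

/-- Any algorithm that solves the FC-problem can be used to solve the
FF-problem: if there exists an FC-algorithm in w weighings for N coins, then
there exists an FF-algorithm in w weighings for N coins. -/
theorem fc_algorithm_to_ff_algorithm (N w : ℕ) (h : FCAlgorithm N w) :
    FFAlgorithm N w := by
  obtain ⟨t, hwf, hd, ht⟩ := h
  refine ⟨t, hwf, hd, fun f₁ f₂ hne => ?_⟩
  obtain ⟨hcard, h₁⟩ := ht f₁ f₂ hne _ (reaches_ffRun f₁ f₂ t)
  obtain ⟨-, h₂⟩ := ht f₂ f₁ hne.symm _ (reaches_ffRun f₂ f₁ t)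
  rw [ffRun_comm] at h₂
  refine (Finset.eq_of_subset_of_card_le ?_ ?_).symm
  · simp [Finset.insert_subset_iff, h₁, h₂]
  · rwa [Finset.card_pair hne]
end

section
/- A scaling of a scalable (w,N)-solution produces a scalable (w+2,3N)-solution; consequently, if a scalable (w,N)-solution exists, then for every integer k ≥ 0 a (w+2k, N·3^k)-solution exists. -/
section Scalability

open Finset

/-- The signed position of a coin in a weighing: `1` on the left pan `A`, `-1` on the right pan
`B`, and `0` off the scale. -/
def tilt {M : ℕ} (A B : Finset (Fin M)) (x : Fin M) : ℤ :=
  (if x ∈ A then 1 else 0) - (if x ∈ B then 1 else 0)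

/-- The outcome of a weighing in terms of pan sizes and coin positions. -/
def outcome {M : ℕ} (A B : Finset (Fin M)) (f c : Fin M) (b : Bool) : Ordering :=
  compare ((#A : ℤ) - #B) (tilt A B f + if b then tilt A B c else 0)

lemma sum_coinWeight {M : ℕ} {f c : Fin M} (hfc : f ≠ c) (b : Bool) (A : Finset (Fin M)) :
    ((∑ x ∈ A, coinWeight f c b x : ℕ) : ℤ) =
      #A - (if f ∈ A then 1 else 0) - (if b then (if c ∈ A then 1 else 0) else 0) := by
  have h : ∀ x, (coinWeight f c b x : ℤ) =
      1 - (if x = f then 1 else 0) - (if b then (if x = c then 1 else 0) else 0) := by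
    intro x
    unfold coinWeight
    rcases eq_or_ne x f with rfl | hx
    · simp [hfc]
    · cases b <;> by_cases hc : x = c <;> simp [hx, hc] <;> simp_all
  push_cast
  rw [Finset.sum_congr rfl fun x _ => h x]
  cases b <;> simp [Finset.sum_sub_distrib, Finset.sum_ite_eq']

lemma weighOutcome_eq_outcome {M : ℕ} {f c : Fin M} (hfc : f ≠ c) (b : Bool)
    (A B : Finset (Fin M)) : weighOutcome f c b A B = outcome A B f c b := by
  have hA := sum_coinWeight hfc b A
  have hB := sum_coinWeight hfc b B
  have key : ∀ (m n : ℕ) (x y : ℤ), (m : ℤ) - n = x - y → compare m n = compare x y := by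
    intro m n x y h
    rcases lt_trichotomy m n with h' | h' | h'
    · rw [compare_lt_iff_lt.2 h', compare_lt_iff_lt.2 (by omega)]
    · rw [compare_eq_iff_eq.2 h', compare_eq_iff_eq.2 (by omega)]
    · rw [compare_gt_iff_gt.2 h', compare_gt_iff_gt.2 (by omega)]
  refine key _ _ _ _ ?_
  rw [hA, hB]
  unfold tilt
  cases b <;> simp <;> ring

/-- All weighings of the strategy put equally many coins on the two disjoint pans. -/
def EvenPans {M : ℕ} : FCTree M → Prop
  | .output _ => True
  | .weigh A B child => Disjoint A B ∧ #A = #B ∧ ∀ o, EvenPans (child o)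

/-- Every run of the strategy with fake `f` and chameleon `c` ends in a valid output.  The case
`f = c` stands for a fake coin without a chameleon; then the output has to be `{f}`. -/
def Correct {M : ℕ} (f c : Fin M) : FCTree M → Prop
  | .output S => #S ≤ 2 ∧ f ∈ S ∧ (f = c → S = {f})
  | .weigh A B child => ∀ b, Correct f c (child (outcome A B f c b))

/-- The possible placements `R f c` (fake `f`, chameleon `c`, or no chameleon if `f = c`) are
resolved by some strategy with even pans in at most `n` weighings. -/
def Solvable {M : ℕ} (n : ℕ) (R : Fin M → Fin M → Prop) : Prop :=
  ∃ t : FCTree M, EvenPans t ∧ t.depth ≤ n ∧ ∀ f c, R f c → Correct f c t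

/-- The strategy is valid for all placements `R f c` with `f ≠ c`, without any restriction on
the sizes of the pans. -/
def Resolves {M : ℕ} (t : FCTree M) (R : Fin M → Fin M → Prop) : Prop :=
  t.WF ∧ ∀ f c, R f c → f ≠ c → ∀ S, Reaches f c t S → #S ≤ 2 ∧ f ∈ S

/-- The placements that remain possible after a weighing with outcome `o`. -/
def after {M : ℕ} (R : Fin M → Fin M → Prop) (A B : Finset (Fin M)) (o : Ordering) :
    Fin M → Fin M → Prop :=
  fun f c => R f c ∧ ∃ b, outcome A B f c b = o

/-- If a fake coin without chameleon is possible, then so is this fake with any chameleon. -/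
def LoneClosed {M : ℕ} (R : Fin M → Fin M → Prop) : Prop :=
  ∀ f, R f f → ∀ c, R f c

/-- The placements of the scaled problem that project to `R`. -/
def pull {N : ℕ} (R : Fin N → Fin N → Prop) : Fin (3 * N) → Fin (3 * N) → Prop :=
  fun x y => R (coinGroup x) (coinGroup y)

lemma compare_zero_two_mul (z : ℤ) : compare 0 (z + z) = compare 0 z := by
  rcases lt_trichotomy 0 z with h | h | h
  · rw [compare_lt_iff_lt.2 h, compare_lt_iff_lt.2 (by omega)]
  · rw [compare_eq_iff_eq.2 h, compare_eq_iff_eq.2 (by omega)]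
  · rw [compare_gt_iff_gt.2 h, compare_gt_iff_gt.2 (by omega)]

lemma outcome_of_card_eq {M : ℕ} {A B : Finset (Fin M)} (h : #A = #B) (f c : Fin M) (b : Bool) :
    outcome A B f c b = compare 0 (tilt A B f + if b then tilt A B c else 0) := by
  simp [outcome, h]

lemma outcome_self {M : ℕ} {A B : Finset (Fin M)} (h : #A = #B) (f : Fin M) (b : Bool) :
    outcome A B f f b = compare 0 (tilt A B f) := by
  rw [outcome_of_card_eq h]
  cases b
  · simp
  · simpa using compare_zero_two_mul _

lemma tilt_le {M : ℕ} (A B : Finset (Fin M)) (x : Fin M) : tilt A B x ≤ 1 := by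
  unfold tilt; split_ifs <;> simp

lemma neg_one_le_tilt {M : ℕ} (A B : Finset (Fin M)) (x : Fin M) : -1 ≤ tilt A B x := by
  unfold tilt; split_ifs <;> simp

lemma FCTree.depth_child_lt {M : ℕ} {A B : Finset (Fin M)} {child : Ordering → FCTree M} {n : ℕ}
    (h : (FCTree.weigh A B child).depth ≤ n) (o : Ordering) : (child o).depth + 1 ≤ n := by
  simp only [FCTree.depth] at h
  cases o <;> omega

lemma FCTree.depth_weigh_le {M : ℕ} {A B : Finset (Fin M)} {child : Ordering → FCTree M} {n : ℕ}
    (h : ∀ o, (child o).depth ≤ n) : (FCTree.weigh A B child).depth ≤ n + 1 := by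
  have h1 := h .lt
  have h2 := h .eq
  have h3 := h .gt
  simp only [FCTree.depth]
  omega

namespace Solvable

variable {M n : ℕ} {R R' : Fin M → Fin M → Prop}

lemma mono (h : Solvable n R) (hR : ∀ f c, R' f c → R f c) {m : ℕ} (hm : n ≤ m) :
    Solvable m R' := by
  obtain ⟨t, h1, h2, h3⟩ := h
  exact ⟨t, h1, h2.trans hm, fun f c hfc => h3 f c (hR f c hfc)⟩

lemma weigh {A B : Finset (Fin M)} (hd : Disjoint A B) (hc : #A = #B)
    (h : ∀ o, Solvable n (after R A B o)) : Solvable (n + 1) R := by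
  choose child h1 h2 h3 using h
  exact ⟨.weigh A B child, ⟨hd, hc, h1⟩, FCTree.depth_weigh_le h2,
    fun f c hfc b => h3 _ f c ⟨hfc, b, rfl⟩⟩

end Solvable

lemma EvenPans.wf {M : ℕ} {t : FCTree M} (h : EvenPans t) : t.WF := by
  induction t with
  | output S => trivial
  | weigh A B ch ih => exact ⟨h.1, fun o => ih o (h.2.2 o)⟩

namespace Resolves

variable {M : ℕ} {R : Fin M → Fin M → Prop}

lemma child {A B : Finset (Fin M)} {ch : Ordering → FCTree M} (h : Resolves (.weigh A B ch) R)
    (o : Ordering) : Resolves (ch o) (after R A B o) := by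
  refine ⟨h.1.2 o, ?_⟩
  rintro f c ⟨hfc, b, hb⟩ hne S hS
  refine h.2 f c hfc hne S (.weigh A B ch b S ?_)
  rwa [weighOutcome_eq_outcome hne, hb]

lemma of_correct {t : FCTree M} (ht : EvenPans t) (h : ∀ f c, R f c → Correct f c t) :
    Resolves t R := by
  refine ⟨ht.wf, fun f c hfc hne S hS => ?_⟩
  have := h f c hfc
  clear hfc h ht
  induction hS with
  | output S => exact ⟨this.1, this.2.1⟩
  | weigh A B ch b S _ ih =>
    apply ih
    rw [weighOutcome_eq_outcome hne]
    exact this b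

lemma swap {A B : Finset (Fin M)} {ch : Ordering → FCTree M} (h : Resolves (.weigh A B ch) R) :
    Resolves (.weigh B A fun o => ch o.swap) R := by
  refine ⟨⟨h.1.1.symm, fun o => h.1.2 _⟩, fun f c hfc hne S hS => ?_⟩
  cases hS with
  | weigh _ _ _ b _ hS =>
    refine h.2 f c hfc hne S (.weigh A B ch b S ?_)
    have : (weighOutcome f c b B A).swap = weighOutcome f c b A B := by
      simp [weighOutcome, Nat.compare_swap]
    rw [← this]
    exact hS

end Resolves

lemma LoneClosed.after_even {M : ℕ} {R : Fin M → Fin M → Prop} (h : LoneClosed R)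
    {A B : Finset (Fin M)} (hc : #A = #B) (o : Ordering) : LoneClosed (after R A B o) := by
  rintro f ⟨hf, b, hb⟩ c
  refine ⟨h f hf c, false, ?_⟩
  rw [outcome_self hc] at hb
  simp [outcome_of_card_eq hc, hb]

/-! ### Groups of three coins -/

/-- The `i`-th coin of the group `F`. -/
def groupCoin {N : ℕ} (F : Fin N) (i : Fin 3) : Fin (3 * N) :=
  ⟨3 * F.val + i.val, by have := F.isLt; have := i.isLt; omega⟩

@[simp] lemma coinGroup_groupCoin {N : ℕ} (F : Fin N) (i : Fin 3) :
    coinGroup (groupCoin F i) = F := by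
  have := i.isLt
  ext; simp only [coinGroup, groupCoin]; omega

lemma groupCoin_injective {N : ℕ} {F G : Fin N} {i j : Fin 3}
    (h : groupCoin F i = groupCoin G j) : F = G ∧ i = j := by
  have h1 := congrArg Fin.val h
  simp only [groupCoin] at h1
  have := i.isLt
  have := j.isLt
  constructor <;> ext <;> omega

lemma exists_groupCoin {N : ℕ} (x : Fin (3 * N)) : ∃ i, groupCoin (coinGroup x) i = x :=
  ⟨⟨x.val % 3, by omega⟩, by ext; simp only [groupCoin, coinGroup]; omega⟩

@[simp] lemma mem_expandPan {N : ℕ} {A : Finset (Fin N)} {x : Fin (3 * N)} :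
    x ∈ expandPan A ↔ coinGroup x ∈ A := by simp [expandPan]

lemma card_expandPan {N : ℕ} (A : Finset (Fin N)) : #(expandPan A) = 3 * #A := by
  have : expandPan A = (A ×ˢ (univ : Finset (Fin 3))).image fun p => groupCoin p.1 p.2 := by
    ext x
    simp only [mem_expandPan, mem_image, mem_product, mem_univ, and_true, Prod.exists]
    constructor
    · intro h
      obtain ⟨i, hi⟩ := exists_groupCoin x
      exact ⟨_, i, h, hi⟩
    · rintro ⟨F, i, hF, rfl⟩
      simpa using hF
  rw [this, card_image_of_injective, card_product]
  · simp [mul_comm]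
  · rintro ⟨F, i⟩ ⟨G, j⟩ h
    obtain ⟨rfl, rfl⟩ := groupCoin_injective h
    rfl

@[simp] lemma tilt_expandPan {N : ℕ} (A B : Finset (Fin N)) (x : Fin (3 * N)) :
    tilt (expandPan A) (expandPan B) x = tilt A B (coinGroup x) := by
  simp [tilt]

lemma disjoint_expandPan {N : ℕ} {A B : Finset (Fin N)} (h : Disjoint A B) :
    Disjoint (expandPan A) (expandPan B) := by
  rw [Finset.disjoint_left] at *
  intro x hx
  simpa using h (mem_expandPan.1 hx)

lemma outcome_expandPan {N : ℕ} {A B : Finset (Fin N)} (hc : #A = #B) (x y : Fin (3 * N))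
    (b : Bool) :
    outcome (expandPan A) (expandPan B) x y b = outcome A B (coinGroup x) (coinGroup y) b := by
  rw [outcome_of_card_eq hc, outcome_of_card_eq (by simp [card_expandPan, hc])]
  simp

lemma after_pull {N : ℕ} (R : Fin N → Fin N → Prop) {A B : Finset (Fin N)} (hc : #A = #B)
    (o : Ordering) : after (pull R) (expandPan A) (expandPan B) o = pull (after R A B o) := by
  funext x y
  simp only [after, pull, outcome_expandPan hc]

lemma LoneClosed.pull {N : ℕ} {R : Fin N → Fin N → Prop} (h : LoneClosed R) :
    LoneClosed (pull R) := fun _ hf _ => h _ hf _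

lemma Solvable.weigh_groups {N n : ℕ} {R : Fin N → Fin N → Prop} {A B : Finset (Fin N)}
    (hd : Disjoint A B) (hc : #A = #B) (h : ∀ o, Solvable n (pull (after R A B o))) :
    Solvable (n + 1) (pull R) :=
  Solvable.weigh (disjoint_expandPan hd) (by simp [card_expandPan, hc])
    fun o => by rw [after_pull R hc]; exact h o

/-! ### Transfer of explicit strategies on a few coins -/

/-- A strategy on `q` coins, carried out on `q` selected coins. -/
def FCTree.embed {q M : ℕ} (e : Fin q → Fin M) : FCTree q → FCTree M
  | .output S => .output (S.image e)
  | .weigh A B child => .weigh (A.image e) (B.image e) fun o => (child o).embed e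

/-- Decidable form of `EvenPans`. -/
def evenCheck {q : ℕ} : FCTree q → Bool
  | .output _ => true
  | .weigh A B child => decide (Disjoint A B) && decide (#A = #B) &&
      (evenCheck (child .lt) && evenCheck (child .eq) && evenCheck (child .gt))

/-- Decidable form of `Correct` on even strategies; the chameleon `none` is never weighed. -/
def correctCheck {q : ℕ} (i : Fin q) (c : Option (Fin q)) : FCTree q → Bool
  | .output S => decide (#S ≤ 2) && decide (i ∈ S) && decide (c = some i → S = {i})
  | .weigh A B child => correctCheck i c (child (compare 0 (tilt A B i))) &&
      correctCheck i c (child (compare 0 (tilt A B i + c.elim 0 (tilt A B))))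

lemma tilt_image {q M : ℕ} {e : Fin q → Fin M} (he : e.Injective) (A B : Finset (Fin q))
    (i : Fin q) : tilt (A.image e) (B.image e) (e i) = tilt A B i := by
  simp [tilt, he.eq_iff]

lemma tilt_image_of_ne {q M : ℕ} {e : Fin q → Fin M} {c : Fin M} (hc : ∀ j, e j ≠ c)
    (A B : Finset (Fin q)) : tilt (A.image e) (B.image e) c = 0 := by
  simp [tilt, hc]

lemma evenPans_embed {q M : ℕ} {e : Fin q → Fin M} (he : e.Injective) {t : FCTree q}
    (ht : evenCheck t = true) : EvenPans (t.embed e) := by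
  induction t with
  | output S => trivial
  | weigh A B child ih =>
    simp only [evenCheck, Bool.and_eq_true, decide_eq_true_eq] at ht
    refine ⟨(disjoint_image he).2 ht.1.1, ?_, fun o => ih o ?_⟩
    · rw [card_image_of_injective _ he, card_image_of_injective _ he, ht.1.2]
    · cases o
      · exact ht.2.1.1
      · exact ht.2.1.2
      · exact ht.2.2

lemma depth_embed {q M : ℕ} (e : Fin q → Fin M) (t : FCTree q) :
    (t.embed e).depth = t.depth := by
  induction t with
  | output S => rfl
  | weigh A B child ih => simp only [FCTree.embed, FCTree.depth, ih]

lemma correct_embed {q M : ℕ} {e : Fin q → Fin M} (he : e.Injective) {t : FCTree q}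
    (ht : evenCheck t = true) {i : Fin q} {o : Option (Fin q)} {c : Fin M}
    (hc : ∀ j, e j = c ↔ o = some j) (h : correctCheck i o t = true) :
    Correct (e i) c (t.embed e) := by
  induction t with
  | output S =>
    simp only [correctCheck, Bool.and_eq_true, decide_eq_true_eq] at h
    refine ⟨card_image_le.trans h.1.1, mem_image_of_mem e h.1.2, fun hi => ?_⟩
    rw [h.2 ((hc i).1 hi), image_singleton]
  | weigh A B child ih =>
    simp only [evenCheck, Bool.and_eq_true, decide_eq_true_eq] at ht
    simp only [correctCheck, Bool.and_eq_true] at h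
    have hcard : #(A.image e) = #(B.image e) := by
      rw [card_image_of_injective _ he, card_image_of_injective _ he, ht.1.2]
    have hch : ∀ o, evenCheck (child o) = true := by
      intro o
      cases o
      · exact ht.2.1.1
      · exact ht.2.1.2
      · exact ht.2.2
    have hcam : tilt (A.image e) (B.image e) c = o.elim 0 (tilt A B) := by
      cases o with
      | none => exact tilt_image_of_ne (by simpa using hc) A B
      | some j => rw [← (hc j).2 rfl, tilt_image he]; rfl
    intro b
    rw [outcome_of_card_eq hcard, tilt_image he, hcam]
    cases b
    · simpa using ih _ (hch _) h.1
    · simpa using ih _ (hch _) h.2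

lemma Solvable.of_model {q M n : ℕ} {e : Fin q → Fin M} (he : e.Injective) (t : FCTree q)
    (Q : Fin q → Option (Fin q) → Bool) (ht : evenCheck t = true) (hd : t.depth ≤ n)
    (hQ : ∀ i o, Q i o = true → correctCheck i o t = true) {R : Fin M → Fin M → Prop}
    (hR : ∀ f c, R f c → ∃ i, e i = f ∧ (∀ j, e j = c → Q i (some j) = true) ∧
      ((∀ j, e j ≠ c) → Q i none = true)) : Solvable n R := by
  refine ⟨t.embed e, evenPans_embed he ht, (depth_embed e t).trans_le hd, fun f c hfc => ?_⟩
  obtain ⟨i, rfl, h1, h2⟩ := hR f c hfc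
  by_cases h : ∃ j, e j = c
  · obtain ⟨j, rfl⟩ := h
    exact correct_embed he ht (o := some j) (by simp [he.eq_iff, eq_comm]) (hQ _ _ (h1 j rfl))
  · push Not at h
    exact correct_embed he ht (o := none) (by simpa using h) (hQ _ _ (h2 h))

/-- The coins of the groups selected by `γ`. -/
def groupEmb {p N : ℕ} (γ : Fin p → Fin N) (x : Fin (3 * p)) : Fin (3 * N) :=
  groupCoin (γ (coinGroup x)) ⟨x.val % 3, by omega⟩

lemma groupEmb_injective {p N : ℕ} {γ : Fin p → Fin N} (hγ : γ.Injective) :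
    (groupEmb γ).Injective := by
  intro x y h
  obtain ⟨h1, h2⟩ := groupCoin_injective h
  have h3 := congrArg Fin.val (hγ h1)
  have h4 := congrArg Fin.val h2
  simp only [coinGroup] at h3 h4
  ext; omega

@[simp] lemma coinGroup_groupEmb {p N : ℕ} (γ : Fin p → Fin N) (x : Fin (3 * p)) :
    coinGroup (groupEmb γ x) = γ (coinGroup x) := by
  simp [groupEmb]

lemma exists_groupEmb {p N : ℕ} (γ : Fin p → Fin N) {k : Fin p} {x : Fin (3 * N)}
    (h : γ k = coinGroup x) : ∃ i, coinGroup i = k ∧ groupEmb γ i = x := by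
  obtain ⟨i, hi⟩ := exists_groupCoin x
  refine ⟨groupCoin k i, by simp, ?_⟩
  rw [← hi, groupEmb, coinGroup_groupCoin, h]
  congr 1
  ext; simp only [groupCoin]; omega

lemma Solvable.of_group_model {p N n : ℕ} {γ : Fin p → Fin N} (hγ : γ.Injective)
    (t : FCTree (3 * p)) (Q : Fin p → Option (Fin p) → Bool) (ht : evenCheck t = true)
    (hd : t.depth ≤ n)
    (hQ : ∀ i o, Q (coinGroup i) (o.map coinGroup) = true → correctCheck i o t = true)
    {R : Fin N → Fin N → Prop}
    (hR : ∀ f c, R f c → ∃ i, γ i = f ∧ (∀ j, γ j = c → Q i (some j) = true) ∧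
      ((∀ j, γ j ≠ c) → Q i none = true)) : Solvable n (pull R) := by
  refine Solvable.of_model (groupEmb_injective hγ) t
    (fun i o => Q (coinGroup i) (o.map coinGroup)) ht hd hQ fun f c hfc => ?_
  obtain ⟨k, hk, h1, h2⟩ := hR _ _ hfc
  obtain ⟨i, rfl, hi⟩ := exists_groupEmb γ hk
  refine ⟨i, hi, fun j hj => h1 _ ?_, fun hj => h2 fun j hj' => ?_⟩
  · rw [← hj, coinGroup_groupEmb]
  · obtain ⟨i', -, hi'⟩ := exists_groupEmb γ hj'
    exact hj i' hi'

/-- Two possible fakes. -/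
lemma Solvable.of_pair {M : ℕ} {R : Fin M → Fin M → Prop} {x y : Fin M}
    (h : ∀ f c, R f c → f = x ∨ f = y) : Solvable 1 R := by
  rcases eq_or_ne x y with rfl | hxy
  · exact ⟨.output {x}, trivial, by simp [FCTree.depth], fun f c hfc => by
      obtain rfl : f = x := by simpa using h f c hfc
      simp [Correct]⟩
  have he : Function.Injective ![x, y] := by
    simp [Function.Injective, Fin.forall_fin_succ, hxy, hxy.symm]
  refine Solvable.of_model he (.weigh {0} {1} fun
    | .lt => .output {0}
    | .eq => .output {0, 1}
    | .gt => .output {1}) (fun _ _ => true) (by decide) (by decide) (by decide) ?_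
  intro f c hfc
  rcases h f c hfc with rfl | rfl
  · exact ⟨0, by simp⟩
  · exact ⟨1, by simp⟩

/-- A strategy for three coins in two weighings. -/
def threeTree : FCTree 3 :=
  .weigh {0} {1} fun
    | .lt => .weigh {0} {2} fun
      | .lt => .output {0}
      | .eq => .output {0, 2}
      | .gt => .output {2}
    | .eq => .weigh {0} {2} fun
      | .lt => .output {0, 1}
      | .eq => .output {1, 2}
      | .gt => .output {2}
    | .gt => .weigh {1} {2} fun
      | .lt => .output {1}
      | .eq => .output {1, 2}
      | .gt => .output {2}

/-- Three possible fakes. -/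
lemma Solvable.of_triple {M : ℕ} {R : Fin M → Fin M → Prop} {x y z : Fin M}
    (h : ∀ f c, R f c → f = x ∨ f = y ∨ f = z) : Solvable 2 R := by
  by_cases hxy : x = y
  · exact (of_pair (x := x) (y := z) (by subst hxy; simpa using h)).mono (fun _ _ => id)
      (by simp)
  by_cases hxz : x = z
  · exact (of_pair (x := x) (y := y) fun f c hfc => by have := h f c hfc; grind).mono
      (fun _ _ => id) (by simp)
  by_cases hyz : y = z
  · exact (of_pair (x := x) (y := y) fun f c hfc => by have := h f c hfc; grind).mono
      (fun _ _ => id) (by simp)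
  have he : Function.Injective ![x, y, z] := by
    simp [Function.Injective, Fin.forall_fin_succ]
    grind
  refine Solvable.of_model he threeTree (fun _ _ => true) (by decide) (by decide) (by decide) ?_
  intro f c hfc
  rcases h f c hfc with rfl | rfl | rfl
  · exact ⟨0, by simp⟩
  · exact ⟨1, by simp⟩
  · exact ⟨2, by simp⟩

/-- Three possible fakes, two of which cannot both be light. -/
lemma Solvable.of_triple_antisymm {M : ℕ} {R : Fin M → Fin M → Prop} {x y z : Fin M}
    (h : ∀ f c, R f c → f = x ∨ f = y ∨ f = z) (hl : ∀ f, ¬ R f f)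
    (hR : R x y → ¬ R y x) : Solvable 1 R := by
  by_cases hxy : x = y
  · exact of_pair (x := x) (y := z) (by subst hxy; simpa using h)
  by_cases hxz : x = z
  · exact of_pair (x := x) (y := y) fun f c hfc => by have := h f c hfc; grind
  by_cases hyz : y = z
  · exact of_pair (x := x) (y := y) fun f c hfc => by have := h f c hfc; grind
  wlog hyx : ¬ R y x generalizing x y
  · exact this (fun f c hfc => by have := h f c hfc; grind) (by tauto) (Ne.symm hxy) hyz hxz
      (fun h' => hR h' (by tauto))
  have he : Function.Injective ![x, y, z] := by
    simp [Function.Injective, Fin.forall_fin_succ]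
    grind
  refine Solvable.of_model he (.weigh {0} {1} fun
    | .lt => .output {0, 2}
    | .eq => .output {0, 2}
    | .gt => .output {1, 2}) (fun i o => decide (o ≠ some i ∧ ¬ (i = 1 ∧ o = some 0)))
    (by decide) (by decide) (by decide) ?_
  intro f c hfc
  rcases h f c hfc with rfl | rfl | rfl
  · refine ⟨0, rfl, fun j hj => ?_, by simp⟩
    fin_cases j <;> simp at hj ⊢
    subst hj; exact hl _ hfc
  · refine ⟨1, rfl, fun j hj => ?_, by simp⟩
    fin_cases j <;> simp at hj ⊢
    · subst hj; exact hyx hfc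
    · subst hj; exact hl _ hfc
  · refine ⟨2, rfl, fun j hj => ?_, by simp⟩
    fin_cases j <;> simp at hj ⊢
    subst hj; exact hl _ hfc

/-- One possible group of the fake. -/
lemma Solvable.of_group {N : ℕ} {R : Fin N → Fin N → Prop} {F : Fin N}
    (h : ∀ f c, R f c → f = F) : Solvable 2 (pull R) := by
  refine Solvable.of_triple (x := groupCoin F 0) (y := groupCoin F 1) (z := groupCoin F 2) ?_
  intro f c hfc
  obtain ⟨i, hi⟩ := exists_groupCoin f
  rw [h _ _ hfc] at hi
  fin_cases i <;> simp [← hi]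

/-- Two possible groups of the fake, and the chameleon is in another group than the fake. -/
lemma Solvable.of_two_groups {N : ℕ} {R : Fin N → Fin N → Prop} {F G : Fin N}
    (h : ∀ f c, R f c → f = F ∨ f = G) (hl : ∀ f, ¬ R f f) : Solvable 2 (pull R) := by
  rcases eq_or_ne F G with rfl | hFG
  · exact of_group (F := F) (by simpa using h)
  have hγ : Function.Injective ![F, G] := by
    simp [Function.Injective, Fin.forall_fin_succ, hFG, hFG.symm]
  let k : Ordering → Fin 3
    | .lt => 0
    | .eq => 2
    | .gt => 1
  refine Solvable.of_group_model hγ (.weigh {0} {1} fun o => .weigh {3} {4} fun o' =>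
      .output {groupCoin 0 (k o), groupCoin 1 (k o')}) (fun i o => decide (o ≠ some i))
    (by decide) (by decide) (by decide) ?_
  intro f c hfc
  rcases h f c hfc with rfl | rfl
  · refine ⟨0, rfl, fun j hj => ?_, by simp⟩
    fin_cases j <;> simp at hj ⊢
    subst hj; exact hl _ hfc
  · refine ⟨1, rfl, fun j hj => ?_, by simp⟩
    fin_cases j <;> simp at hj ⊢
    subst hj; exact hl _ hfc

/-- Two possible groups of the fake, one of which excludes several groups of the chameleon. -/
lemma Solvable.of_two_groups_of_excluded {N : ℕ} {R : Fin N → Fin N → Prop} {F G H : Fin N}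
    (h : ∀ f c, R f c → f = F ∨ f = G) (hFG : F ≠ G) (hFH : F ≠ H) (hGH : G ≠ H)
    (hGF' : ¬ R G F) (hGG' : ¬ R G G) (hGH' : ¬ R G H) : Solvable 2 (pull R) := by
  have hγ : Function.Injective ![F, G, H] := by
    simp [Function.Injective, Fin.forall_fin_succ]
    grind
  refine Solvable.of_group_model hγ (.weigh {1, 5} {2, 3} fun
      | .lt => .weigh {0, 5, 6} {1, 2, 3} fun
        | .lt => .output {0, 5}
        | .eq => .output {0, 1}
        | .gt => .output {1}
      | .eq => .weigh {0, 6} {1, 2} fun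
        | .lt => .output {0}
        | .eq => .output {0, 4}
        | .gt => .output {1, 2}
      | .gt => .weigh {0, 3, 6} {1, 2, 4} fun
        | .lt => .output {0, 3}
        | .eq => .output {0, 2}
        | .gt => .output {2})
    (fun i o => decide (i = 0 ∨ (i = 1 ∧ o = none)))
    (by decide) (by decide) (by decide) ?_
  intro f c hfc
  rcases h f c hfc with rfl | rfl
  · exact ⟨0, by simp⟩
  · refine ⟨1, rfl, fun j hj => ?_, by simp⟩
    fin_cases j <;> simp at hj ⊢ <;> subst hj
    · exact hGF' hfc
    · exact hGG' hfc
    · exact hGH' hfc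

/-! ### Uneven weighings -/

section Uneven

variable {M : ℕ} {R : Fin M → Fin M → Prop} {A B : Finset (Fin M)}

lemma after_gt_of_card_add_two_le (h : #B + 2 ≤ #A) : after R A B .gt = R := by
  funext f c
  have h1 := tilt_le A B f
  simp only [after, eq_iff_iff, and_iff_left_iff_imp]
  intro _
  refine ⟨false, ?_⟩
  simp only [outcome, Bool.false_eq_true, if_false, compare_gt_iff_gt]
  omega

lemma after_eq_iff (hd : Disjoint A B) (h : #A = #B + 1) {f c : Fin M} :
    after R A B .eq f c ↔ R f c ∧ (f ∈ A ∨ (f ∉ B ∧ c ∈ A)) := by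
  have hf : f ∈ A → f ∉ B := fun h => Finset.disjoint_left.1 hd h
  have hc : c ∈ A → c ∉ B := fun h => Finset.disjoint_left.1 hd h
  simp only [after, outcome, h, Bool.exists_bool, compare_eq_iff_eq, tilt]
  by_cases h1 : f ∈ A <;> by_cases h2 : f ∈ B <;> by_cases h3 : c ∈ A <;> by_cases h4 : c ∈ B <;>
    simp_all

lemma after_gt_iff (hd : Disjoint A B) (h : #A = #B + 1) {f c : Fin M} :
    after R A B .gt f c ↔ R f c ∧ (f ∉ A ∨ c ∈ B) := by
  have hf : f ∈ A → f ∉ B := fun h => Finset.disjoint_left.1 hd h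
  have hc : c ∈ A → c ∉ B := fun h => Finset.disjoint_left.1 hd h
  simp only [after, outcome, h, Bool.exists_bool, compare_gt_iff_gt, tilt]
  by_cases h1 : f ∈ A <;> by_cases h2 : f ∈ B <;> by_cases h3 : c ∈ A <;> by_cases h4 : c ∈ B <;>
    simp_all

lemma LoneClosed.after_eq (hR : LoneClosed R) (hd : Disjoint A B) (h : #A = #B + 1) :
    LoneClosed (after R A B .eq) := by
  intro f hf c
  rw [after_eq_iff hd h] at *
  exact ⟨hR f hf.1 c, by tauto⟩

lemma LoneClosed.after_gt (hR : LoneClosed R) (hd : Disjoint A B) (h : #A = #B + 1) :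
    LoneClosed (after R A B .gt) := by
  intro f hf c
  rw [after_gt_iff hd h] at *
  have : f ∈ A → f ∉ B := fun h => Finset.disjoint_left.1 hd h
  exact ⟨hR f hf.1 c, by tauto⟩

lemma outcome_erase (hd : Disjoint A B) (h : #A = #B + 1) {a : Fin M} (ha : a ∈ A) {f c : Fin M}
    {b : Bool} :
    (outcome (A.erase a) B f c b = .lt → (f ∈ A ∨ (f ∉ B ∧ c ∈ A))) ∧
    (outcome (A.erase a) B f c b ≠ .lt → f ∉ A ∨ c ∈ B ∨ f = a) := by
  have hf : f ∈ A → f ∉ B := fun h => Finset.disjoint_left.1 hd h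
  have hc : c ∈ A → c ∉ B := fun h => Finset.disjoint_left.1 hd h
  have hcard : #(A.erase a) = #B := by rw [card_erase_of_mem ha, h, Nat.add_sub_cancel]
  rw [outcome_of_card_eq hcard, Ne, compare_lt_iff_lt]
  simp only [tilt, mem_erase]
  by_cases h1 : f ∈ A <;> by_cases h2 : f ∈ B <;> by_cases h3 : c ∈ A <;> by_cases h4 : c ∈ B <;>
    cases b <;> by_cases h5 : f = a <;> by_cases h6 : c = a <;> simp_all

end Uneven

/-! ### Strategies with at most one weighing -/

lemma FCTree.exists_output {M : ℕ} {t : FCTree M} (h : t.depth ≤ 0) : ∃ S, t = .output S := by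
  cases t with
  | output S => exact ⟨S, rfl⟩
  | weigh A B ch => simp [depth] at h

/-- The coins that can be fake. -/
noncomputable def fakes {M : ℕ} (R : Fin M → Fin M → Prop) : Finset (Fin M) :=
  open Classical in univ.filter fun f => ∃ c, R f c

@[simp] lemma mem_fakes {M : ℕ} {R : Fin M → Fin M → Prop} {f : Fin M} :
    f ∈ fakes R ↔ ∃ c, R f c := by simp [fakes]

lemma fakes_subset_iff {M : ℕ} {R : Fin M → Fin M → Prop} {S : Finset (Fin M)} :
    fakes R ⊆ S ↔ ∀ f c, R f c → f ∈ S := by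
  simp [subset_iff]

lemma LoneClosed.exists_cham_ne {M : ℕ} (hM : 2 ≤ M) {R : Fin M → Fin M → Prop} (hR : LoneClosed R)
    {f c : Fin M} (h : R f c) : ∃ c', f ≠ c' ∧ R f c' := by
  rcases eq_or_ne f c with rfl | hfc
  · have : Nontrivial (Fin M) := Fin.nontrivial_iff_two_le.2 hM
    obtain ⟨c', hc'⟩ := exists_ne f
    exact ⟨c', hc'.symm, hR f h c'⟩
  · exact ⟨c, hfc, h⟩

lemma Resolves.fakes_subset {M : ℕ} (hM : 2 ≤ M) {R : Fin M → Fin M → Prop} (hR : LoneClosed R)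
    {S : Finset (Fin M)} (h : Resolves (.output S) R) : fakes R ⊆ S := by
  rw [fakes_subset_iff]
  intro f c hfc
  obtain ⟨c', hne, hc'⟩ := hR.exists_cham_ne hM hfc
  exact (h.2 f c' hc' hne S (.output S)).2

lemma Resolves.card_fakes_le_two {M : ℕ} (hM : 2 ≤ M) {R : Fin M → Fin M → Prop}
    (hR : LoneClosed R) {t : FCTree M} (h : Resolves t R) (hd : t.depth ≤ 0) :
    #(fakes R) ≤ 2 := by
  obtain ⟨S, rfl⟩ := FCTree.exists_output hd
  rcases (fakes R).eq_empty_or_nonempty with he | ⟨f, hf⟩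
  · simp [he]
  obtain ⟨c, hfc⟩ := mem_fakes.1 hf
  obtain ⟨c', hne, hc'⟩ := hR.exists_cham_ne hM hfc
  exact (card_le_card (h.fakes_subset hM hR)).trans (h.2 f c' hc' hne S (.output S)).1

lemma exists_subset_pair {M : ℕ} (hM : 0 < M) {s : Finset (Fin M)} (hs : #s ≤ 2) :
    ∃ x y, s ⊆ {x, y} := by
  rcases Nat.lt_or_ge #s 1 with h | h
  · exact ⟨⟨0, hM⟩, ⟨0, hM⟩, by simp [card_eq_zero.1 (by omega : #s = 0)]⟩
  · rcases Nat.lt_or_ge #s 2 with h' | h'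
    · obtain ⟨x, rfl⟩ := card_eq_one.1 (by omega : #s = 1)
      exact ⟨x, x, by simp⟩
    · obtain ⟨x, y, -, rfl⟩ := card_eq_two.1 (by omega : #s = 2)
      exact ⟨x, y, subset_rfl⟩

lemma Solvable.of_card_fakes_le_two {M : ℕ} {R : Fin M → Fin M → Prop} (h : #(fakes R) ≤ 2) :
    Solvable 1 R := by
  rcases Nat.eq_zero_or_pos M with rfl | hM
  · exact ⟨.output ∅, trivial, by simp [FCTree.depth], fun f => f.elim0⟩
  obtain ⟨x, y, hxy⟩ := exists_subset_pair hM h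
  rw [fakes_subset_iff] at hxy
  exact of_pair (x := x) (y := y) (by simpa using hxy)

lemma Resolves.solvable_of_depth_zero {M : ℕ} (hM : 2 ≤ M) {R : Fin M → Fin M → Prop}
    (hR : LoneClosed R) {t : FCTree M} (h : Resolves t R) (hd : t.depth ≤ 0) : Solvable 1 R :=
  .of_card_fakes_le_two (h.card_fakes_le_two hM hR hd)

/-- Four possible fakes with the restrictions left by an uneven weighing of `{a, a'}` against
`{b}`. -/
lemma Solvable.of_four {M : ℕ} {R : Fin M → Fin M → Prop} {a a' x y b : Fin M}
    (h : ∀ f c, R f c → f = a ∨ f = a' ∨ f = x ∨ f = y) (haa' : a ≠ a') (hba : b ≠ a)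
    (hba' : b ≠ a') (hxa : x ≠ a) (hxa' : x ≠ a') (hya : y ≠ a) (hya' : y ≠ a') (hxy : x ≠ y)
    (hR : LoneClosed R) (hab : ¬ R a b) (hab' : ¬ R a' b)
    (hf : ∀ f, f ≠ b → f ≠ a → f ≠ a' → ¬ R f a ∧ ¬ R f a') : Solvable 2 R := by
  wlog hby : b ≠ y generalizing x y
  · exact this (x := y) (y := x) (fun f c hfc => by have := h f c hfc; tauto)
      hya hya' hxa hxa' (Ne.symm hxy) (by rintro rfl; simp at hby; exact hxy hby)
  have ha := fun h => hab (hR a h b)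
  have ha' := fun h => hab' (hR a' h b)
  have hy := fun h => (hf y hby.symm hya hya').1 (hR y h a)
  have hy2 := hf y hby.symm hya hya'
  rcases eq_or_ne b x with rfl | hbx
  · have he : Function.Injective ![a, a', b, y] := by
      simp [Function.Injective, Fin.forall_fin_succ]
      grind
    refine Solvable.of_model he (.weigh {0, 2} {1, 3} fun
      | .lt => .weigh {0} {2} fun
        | .lt => .output {0}
        | .eq => .output {0, 2}
        | .gt => .output {2}
      | .eq => .weigh {0, 1} {2, 3} fun
        | .lt => .output {0, 1}
        | .eq => .output {0, 2}
        | .gt => .output {2, 3}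
      | .gt => .weigh {1} {3} fun
        | .lt => .output {1}
        | .eq => .output {1, 3}
        | .gt => .output {3})
      (fun i o => decide (i = 2 ∨ o ≠ some i ∧ if i = 3 then o ≠ some 0 ∧ o ≠ some 1
        else o ≠ some 2))
      (by decide) (by decide) (by decide) ?_
    intro f c hfc
    rcases h f c hfc with rfl | rfl | rfl | rfl
    · refine ⟨0, rfl, fun j hj => ?_, by simp⟩
      fin_cases j <;> simp at hj ⊢ <;> subst hj <;> contradiction
    · refine ⟨1, rfl, fun j hj => ?_, by simp⟩
      fin_cases j <;> simp at hj ⊢ <;> subst hj <;> contradiction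
    · exact ⟨2, rfl, by simp⟩
    · refine ⟨3, rfl, fun j hj => ?_, by simp⟩
      fin_cases j <;> simp at hj ⊢ <;> subst hj <;> tauto
  · have hx2 := hf x hbx.symm hxa hxa'
    have hx := fun h => hx2.1 (hR x h a)
    have he : Function.Injective ![a, a', x, y, b] := by
      simp [Function.Injective, Fin.forall_fin_succ]
      grind
    refine Solvable.of_model he (.weigh {0, 2} {1, 3} fun
      | .lt => .weigh {0} {2} fun
        | .lt => .output {0}
        | .eq => .output {0, 2}
        | .gt => .output {2}
      | .eq => .weigh {0, 1} {2, 3} fun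
        | .lt => .output {0, 1}
        | .eq => .output {0, 1}
        | .gt => .output {2, 3}
      | .gt => .weigh {1} {3} fun
        | .lt => .output {1}
        | .eq => .output {1, 3}
        | .gt => .output {3})
      (fun i o => decide (o ≠ some i ∧ if i < 2 then o ≠ some 4
        else i ≠ 4 ∧ o ≠ some 0 ∧ o ≠ some 1))
      (by decide) (by decide) (by decide) ?_
    intro f c hfc
    rcases h f c hfc with rfl | rfl | rfl | rfl
    · refine ⟨0, rfl, fun j hj => ?_, by simp⟩
      fin_cases j <;> simp at hj ⊢ <;> subst hj <;> contradiction
    · refine ⟨1, rfl, fun j hj => ?_, by simp⟩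
      fin_cases j <;> simp at hj ⊢ <;> subst hj <;> contradiction
    · refine ⟨2, rfl, fun j hj => ?_, by simp⟩
      fin_cases j <;> simp at hj ⊢ <;> subst hj <;> tauto
    · refine ⟨3, rfl, fun j hj => ?_, by simp⟩
      fin_cases j <;> simp at hj ⊢ <;> subst hj <;> tauto

/-- One uneven weighing can be replaced by two even ones. -/
lemma Resolves.solvable_of_depth_one {M : ℕ} (hM : 2 ≤ M) {R : Fin M → Fin M → Prop}
    (hR : LoneClosed R) {t : FCTree M} (h : Resolves t R) (hd : t.depth ≤ 1) :
    Solvable 2 R := by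
  cases t with
  | output S =>
    exact (h.solvable_of_depth_zero hM hR (by simp [FCTree.depth])).mono (fun _ _ => id) (by simp)
  | weigh A B ch =>
  wlog hAB : #B ≤ #A generalizing A B ch
  · refine this B A _ h.swap ?_ (by omega)
    simp only [FCTree.depth] at hd ⊢
    simp only [Ordering.swap]
    omega
  have hch : ∀ o, (ch o).depth ≤ 0 := fun o => by
    have := FCTree.depth_child_lt hd o
    omega
  have hdisj : Disjoint A B := h.1.1
  rcases (by omega : #A = #B ∨ #B + 2 ≤ #A ∨ #A = #B + 1) with hc | hc | hc
  · exact Solvable.weigh hdisj hc fun o =>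
      (h.child o).solvable_of_depth_zero hM (hR.after_even hc o) (hch o)
  · have := h.child .gt
    rw [after_gt_of_card_add_two_le hc] at this
    exact (this.solvable_of_depth_zero hM hR (hch _)).mono (fun _ _ => id) (by simp)
  have hReq := hR.after_eq hdisj hc
  have hRgt := hR.after_gt hdisj hc
  have heq := (h.child .eq).card_fakes_le_two hM hReq (hch _)
  have hgt := (h.child .gt).card_fakes_le_two hM hRgt (hch _)
  by_cases hA : A ⊆ fakes R
  · have hAeq : A ⊆ fakes (after R A B .eq) := by
      intro a ha
      obtain ⟨c, hac⟩ := mem_fakes.1 (hA ha)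
      exact mem_fakes.2 ⟨c, (after_eq_iff hdisj hc).2 ⟨hac, .inl ha⟩⟩
    obtain ⟨x, y, hxy⟩ := exists_subset_pair (by omega) hgt
    simp only [fakes_subset_iff, after_gt_iff hdisj hc, mem_insert, mem_singleton] at hxy
    have hA2 := (card_le_card hAeq).trans heq
    rcases (by omega : #A = 1 ∨ #A = 2) with h1 | h2
    · obtain ⟨a, rfl⟩ := card_eq_one.1 h1
      refine Solvable.of_triple (x := a) (y := x) (z := y) fun f c hfc => ?_
      have := hxy f c
      simp at this
      tauto
    · have hAeq' := eq_of_subset_of_card_le hAeq (by omega)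
      obtain ⟨a, a', haa', rfl⟩ := card_eq_two.1 h2
      obtain ⟨b, rfl⟩ := card_eq_one.1 (by omega : #B = 1)
      have hE : ∀ f c, after R {a, a'} {b} .eq f c → f = a ∨ f = a' := by
        intro f c hfc
        have : f ∈ ({a, a'} : Finset (Fin M)) := hAeq' ▸ mem_fakes.2 ⟨c, hfc⟩
        simpa using this
      simp only [after_eq_iff hdisj hc, mem_insert, mem_singleton] at hE hxy
      have hΦ : ∀ f c, R f c → f = a ∨ f = a' ∨ f = x ∨ f = y := by
        intro f c hfc
        have := hxy f c
        tauto
      simp only [disjoint_singleton_right, mem_insert, mem_singleton, not_or] at hdisj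
      by_cases hdist : x ≠ a ∧ x ≠ a' ∧ y ≠ a ∧ y ≠ a' ∧ x ≠ y
      · obtain ⟨h1, h2, h3, h4, h5⟩ := hdist
        refine Solvable.of_four hΦ haa' hdisj.1 hdisj.2 h1 h2 h3 h4 h5 hR ?_ ?_ ?_
        · intro hab
          have := hxy a b
          grind
        · intro hab
          have := hxy a' b
          grind
        · intro f hfb hfa hfa'
          have := hE f
          constructor <;> intro hf <;> grind
      · by_cases hx : x = a ∨ x = a' ∨ x = y
        · exact Solvable.of_triple (x := a) (y := a') (z := y) fun f c hfc => by
            have := hΦ f c hfc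
            grind
        · exact Solvable.of_triple (x := a) (y := a') (z := x) fun f c hfc => by
            have := hΦ f c hfc
            grind
  · obtain ⟨a, ha, haR⟩ := not_subset.1 hA
    refine Solvable.weigh (hdisj.mono_left (erase_subset a A)) ?_ fun o => ?_
    · rw [card_erase_of_mem ha, hc, Nat.add_sub_cancel]
    by_cases ho : o = .lt
    · refine ((h.child .eq).solvable_of_depth_zero hM hReq (hch _)).mono ?_ le_rfl
      rintro f c ⟨hfc, b, hb⟩
      rw [after_eq_iff hdisj hc]
      exact ⟨hfc, (outcome_erase hdisj hc ha).1 (hb.trans ho)⟩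
    · refine ((h.child .gt).solvable_of_depth_zero hM hRgt (hch _)).mono ?_ le_rfl
      rintro f c ⟨hfc, b, hb⟩
      rw [after_gt_iff hdisj hc]
      refine ⟨hfc, ?_⟩
      rcases (outcome_erase hdisj hc ha (f := f) (c := c) (b := b)).2 (by rwa [hb]) with h | h | rfl
      · exact .inl h
      · exact .inr h
      · exact absurd (mem_fakes.2 ⟨c, hfc⟩) haR

lemma fakes_subset_union {M : ℕ} (R : Fin M → Fin M → Prop) (A B : Finset (Fin M))
    {o₁ o₂ o₃ : Ordering} (ho : ∀ o, o = o₁ ∨ o = o₂ ∨ o = o₃) :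
    fakes R ⊆ fakes (after R A B o₁) ∪ fakes (after R A B o₂) ∪ fakes (after R A B o₃) := by
  rw [fakes_subset_iff]
  intro f c hfc
  simp only [mem_union, mem_fakes]
  rcases ho (outcome A B f c false) with h | h | h
  · exact .inl (.inl ⟨c, hfc, false, h⟩)
  · exact .inl (.inr ⟨c, hfc, false, h⟩)
  · exact .inr ⟨c, hfc, false, h⟩

lemma card_union_three_le {α : Type*} [DecidableEq α] {s t u v : Finset α} (h : s ⊆ t ∪ u ∪ v) :
    #s ≤ #t + #u + #v :=
  (card_le_card h).trans ((card_union_le _ _).trans (Nat.add_le_add_right (card_union_le _ _) _))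

/-- One weighing distinguishes at most six possible fakes, and at most four if it is uneven. -/
lemma Resolves.card_fakes_le {M : ℕ} (hM : 2 ≤ M) {R : Fin M → Fin M → Prop}
    (hR : LoneClosed R) {t : FCTree M} (h : Resolves t R) (hd : t.depth ≤ 1) :
    #(fakes R) ≤ 4 ∨ (#(fakes R) ≤ 6 ∧ ∃ A B ch, t = .weigh A B ch ∧ #A = #B) := by
  cases t with
  | output S =>
    have := h.card_fakes_le_two hM hR (by simp [FCTree.depth])
    omega
  | weigh A B ch =>
  by_cases hc : #A = #B
  · right
    refine ⟨?_, A, B, ch, rfl, hc⟩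
    have key : ∀ o, #(fakes (after R A B o)) ≤ 2 := fun o =>
      (h.child o).card_fakes_le_two hM (hR.after_even hc o)
        (by have := FCTree.depth_child_lt hd o; omega)
    have h1 := card_union_three_le (fakes_subset_union R A B (o₁ := .lt) (o₂ := .eq) (o₃ := .gt)
      (by decide))
    have := key .lt
    have := key .eq
    have := key .gt
    omega
  left
  wlog hAB : #B ≤ #A generalizing A B ch
  · refine this B A _ h.swap ?_ (Ne.symm hc) (by omega)
    simp only [FCTree.depth] at hd ⊢
    simp only [Ordering.swap]
    omega
  have hch : ∀ o, (ch o).depth ≤ 0 := fun o => by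
    have := FCTree.depth_child_lt hd o
    omega
  have hdisj : Disjoint A B := h.1.1
  rcases (by omega : #B + 2 ≤ #A ∨ #A = #B + 1) with hc | hc
  · have := h.child .gt
    rw [after_gt_of_card_add_two_le hc] at this
    have := this.card_fakes_le_two hM hR (hch _)
    omega
  · have h1 := (h.child .eq).card_fakes_le_two hM (hR.after_eq hdisj hc) (hch _)
    have h2 := (h.child .gt).card_fakes_le_two hM (hR.after_gt hdisj hc) (hch _)
    have h3 : fakes R ⊆ fakes (after R A B .eq) ∪ fakes (after R A B .gt) := by
      rw [fakes_subset_iff]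
      intro f c hfc
      simp only [mem_union, mem_fakes, after_eq_iff hdisj hc, after_gt_iff hdisj hc]
      by_cases hf : f ∈ A
      · exact .inl ⟨c, hfc, .inl hf⟩
      · exact .inr ⟨c, hfc, .inl hf⟩
    have := (card_le_card h3).trans (card_union_le _ _)
    omega

/-- With one weighing and six possible fakes, no three coins can be light in pairs. -/
lemma Resolves.not_three_pairs {M : ℕ} (hM : 2 ≤ M) {R : Fin M → Fin M → Prop}
    (hR : LoneClosed R) {t : FCTree M} (h : Resolves t R) (hd : t.depth ≤ 1)
    (hcard : 6 ≤ #(fakes R)) {x y z : Fin M} (hxy : x ≠ y) (hxz : x ≠ z) (hyz : y ≠ z)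
    (h1 : R x y) (h2 : R y x) (h3 : R x z) (h4 : R z x) : False := by
  obtain h | ⟨-, A, B, ch, rfl, hc⟩ := h.card_fakes_le hM hR hd
  · omega
  have key : ∀ o, #(fakes (after R A B o)) ≤ 2 := fun o =>
    (h.child o).card_fakes_le_two hM (hR.after_even hc o)
      (by have := FCTree.depth_child_lt hd o; omega)
  have hpair : ∀ u v, R u v → R v u → ∃ o, u ∈ fakes (after R A B o) ∧
      v ∈ fakes (after R A B o) := by
    intro u v huv hvu
    refine ⟨_, mem_fakes.2 ⟨v, huv, true, rfl⟩, mem_fakes.2 ⟨u, hvu, true, ?_⟩⟩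
    rw [outcome_of_card_eq hc, outcome_of_card_eq hc]
    simp [add_comm]
  have hdisj : ∀ o o', o ≠ o' → x ∈ fakes (after R A B o) → x ∉ fakes (after R A B o') := by
    intro o o' hne hx hx'
    obtain ⟨o'', ho⟩ : ∃ o'', ∀ p, p = o ∨ p = o'' ∨ p = o' :=
      (by decide : ∀ o o' : Ordering, o ≠ o' → ∃ o'', ∀ p, p = o ∨ p = o'' ∨ p = o') o o' hne
    have hsub := fakes_subset_union R A B ho
    have hsub' : fakes R ⊆ fakes (after R A B o) ∪ fakes (after R A B o'') ∪
        (fakes (after R A B o')).erase x := by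
      intro u hu
      have := hsub hu
      simp only [mem_union, mem_erase] at this ⊢
      by_cases hux : u = x
      · subst hux; exact .inl (.inl hx)
      · tauto
    have h5 := card_union_three_le hsub'
    rw [card_erase_of_mem hx'] at h5
    have := key o
    have := key o'
    have := key o''
    omega
  obtain ⟨o, hx, hy⟩ := hpair x y h1 h2
  obtain ⟨o', hx', hz⟩ := hpair x z h3 h4
  obtain rfl : o = o' := by
    by_contra hne
    exact hdisj o o' hne hx hx'
  have : ({x, y, z} : Finset (Fin M)) ⊆ fakes (after R A B o) := by
    intro u hu
    simp only [mem_insert, mem_singleton] at hu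
    rcases hu with rfl | rfl | rfl <;> assumption
  have h6 := card_le_card this
  rw [card_eq_three.2 ⟨x, y, z, hxy, hxz, hyz, rfl⟩] at h6
  have := key o
  omega

/-! ### Counting outputs -/

/-- The sets that occur as outputs of a strategy. -/
def FCTree.outputs {M : ℕ} : FCTree M → Finset (Finset (Fin M))
  | .output S => {S}
  | .weigh _ _ ch => (ch .lt).outputs ∪ (ch .eq).outputs ∪ (ch .gt).outputs

lemma FCTree.outputs_child_subset {M : ℕ} (A B : Finset (Fin M)) (ch : Ordering → FCTree M)
    (o : Ordering) : (ch o).outputs ⊆ (FCTree.weigh A B ch).outputs := by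
  intro S hS
  simp only [outputs, mem_union]
  cases o <;> tauto

lemma FCTree.card_outputs_le {M n : ℕ} {t : FCTree M} (h : t.depth ≤ n) :
    #t.outputs ≤ 3 ^ n := by
  induction t generalizing n with
  | output S => simpa [outputs] using Nat.one_le_pow _ _ (by norm_num)
  | weigh A B ch ih =>
    obtain ⟨n, rfl⟩ : ∃ m, n = m + 1 := ⟨n - 1, by have := depth_child_lt h .lt; omega⟩
    have key : ∀ o, #(ch o).outputs ≤ 3 ^ n := fun o =>
      ih o (by have := depth_child_lt h o; omega)
    have h1 := key .lt
    have h2 := key .eq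
    have h3 := key .gt
    have := card_union_three_le (subset_rfl : (FCTree.weigh A B ch).outputs ⊆ _)
    rw [pow_succ]
    omega

lemma Reaches.mem_outputs {M : ℕ} {f c : Fin M} {t : FCTree M} {S : Finset (Fin M)}
    (h : Reaches f c t S) : S ∈ t.outputs := by
  induction h with
  | output S => simp [FCTree.outputs]
  | weigh A B ch b S _ ih => exact FCTree.outputs_child_subset A B ch _ ih

/-- If the chameleon always imitates the fake, the two cannot be told apart. -/
lemma exists_reaches_both {M : ℕ} {f c : Fin M} (hfc : f ≠ c) (t : FCTree M) :
    ∃ S, Reaches f c t S ∧ Reaches c f t S := by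
  induction t with
  | output S => exact ⟨S, .output S, .output S⟩
  | weigh A B ch ih =>
    obtain ⟨S, h1, h2⟩ := ih (weighOutcome f c true A B)
    refine ⟨S, .weigh A B ch true S h1, .weigh A B ch true S ?_⟩
    have : weighOutcome c f true A B = weighOutcome f c true A B := by
      rw [weighOutcome_eq_outcome hfc, weighOutcome_eq_outcome hfc.symm]
      simp [outcome, add_comm]
    rwa [this]

lemma Resolves.pair_mem_outputs {M : ℕ} {R : Fin M → Fin M → Prop} {t : FCTree M}
    (h : Resolves t R) {x y : Fin M} (hxy : x ≠ y) (h1 : R x y) (h2 : R y x) :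
    {x, y} ∈ t.outputs := by
  obtain ⟨S, hS, hS'⟩ := exists_reaches_both hxy t
  obtain ⟨hc, hx⟩ := h.2 x y h1 hxy S hS
  obtain ⟨-, hy⟩ := h.2 y x h2 hxy.symm S hS'
  have : {x, y} = S := by
    apply eq_of_subset_of_card_le
    · intro u hu
      simp only [mem_insert, mem_singleton] at hu
      rcases hu with rfl | rfl <;> assumption
    · rw [card_pair hxy]; exact hc
  rw [this]
  exact hS.mem_outputs

/-- If two groups can each contain the fake while the other one contains the chameleon, then
resolving this in two weighings leaves room for nothing else. -/
lemma Resolves.of_two_cycle {N : ℕ} {R : Fin N → Fin N → Prop} {t : FCTree (3 * N)}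
    (h : Resolves t (pull R)) (hd : t.depth ≤ 2) {F G : Fin N} (hFG : F ≠ G) (h1 : R F G)
    (h2 : R G F) : (∀ f c, R f c → f = F ∨ f = G) ∧ ∀ f, ¬ R f f := by
  have hne : ∀ {F G : Fin N} (_ : F ≠ G) (i j), groupCoin F i ≠ groupCoin G j :=
    fun hFG i j hij => hFG (groupCoin_injective hij).1
  let P : Fin 3 × Fin 3 → Finset (Fin (3 * N)) := fun p => {groupCoin F p.1, groupCoin G p.2}
  have hP : Function.Injective P := by
    rintro ⟨i, j⟩ ⟨i', j'⟩ hij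
    have hi : groupCoin F i ∈ P (i', j') := hij ▸ by simp [P]
    have hj : groupCoin G j ∈ P (i', j') := hij ▸ by simp [P]
    simp only [P, mem_insert, mem_singleton, hne hFG, hne hFG.symm, or_false, false_or] at hi hj
    rw [(groupCoin_injective hi).2, (groupCoin_injective hj).2]
  have hsub : univ.image P ⊆ t.outputs := by
    rw [image_subset_iff]
    rintro ⟨i, j⟩ -
    exact h.pair_mem_outputs (hne hFG i j) (by simpa [pull] using h1) (by simpa [pull] using h2)
  have heq : univ.image P = t.outputs := by
    refine eq_of_subset_of_card_le hsub ((FCTree.card_outputs_le hd).trans ?_)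
    rw [card_image_of_injective _ hP]
    simp
  have hl : ∀ f, ¬ R f f := by
    intro f hf
    have h01 : groupCoin f 0 ≠ groupCoin f 1 := fun h => by
      have := (groupCoin_injective h).2
      simp at this
    have := h.pair_mem_outputs h01 (by simpa [pull] using hf) (by simpa [pull] using hf)
    rw [← heq] at this
    simp only [mem_image, mem_univ, true_and, Prod.exists, P] at this
    obtain ⟨i, j, hij⟩ := this
    have hF : groupCoin F i ∈ ({groupCoin f 0, groupCoin f 1} : Finset _) := hij ▸ by simp
    have hG : groupCoin G j ∈ ({groupCoin f 0, groupCoin f 1} : Finset _) := hij ▸ by simp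
    simp only [mem_insert, mem_singleton] at hF hG
    have hF' : F = f := by rcases hF with h | h <;> exact (groupCoin_injective h).1
    have hG' : G = f := by rcases hG with h | h <;> exact (groupCoin_injective h).1
    exact hFG (hF'.trans hG'.symm)
  refine ⟨fun f c hfc => ?_, hl⟩
  have hfc' : f ≠ c := by rintro rfl; exact hl f hfc
  obtain ⟨S, hS, -⟩ := exists_reaches_both (hne hfc' 0 0) t
  have hmem := (h.2 _ _ (by simpa [pull] using hfc) (hne hfc' 0 0) S hS).2
  have hSo := hS.mem_outputs
  rw [← heq] at hSo
  simp only [mem_image, mem_univ, true_and, Prod.exists, P] at hSo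
  obtain ⟨i, j, rfl⟩ := hSo
  simp only [mem_insert, mem_singleton] at hmem
  rcases hmem with h | h
  · exact .inl (groupCoin_injective h).1
  · exact .inr (groupCoin_injective h).1

lemma fakes_pull {N : ℕ} (R : Fin N → Fin N → Prop) : fakes (pull R) = expandPan (fakes R) := by
  ext x
  simp only [mem_fakes, mem_expandPan, pull]
  exact ⟨fun ⟨c, h⟩ => ⟨_, h⟩, fun ⟨c, h⟩ => ⟨groupCoin c 0, by simpa using h⟩⟩

/-- At most three groups of the fake. -/
lemma Solvable.of_three_groups {N : ℕ} {R : Fin N → Fin N → Prop} {F G H : Fin N} (hFG : F ≠ G)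
    (hR : LoneClosed R) (hanti : ∀ f c, f ≠ c → R f c → ¬ R c f)
    (h : ∀ f c, R f c → f = F ∨ f = G ∨ f = H) (hl : ∀ f, R f f → f = F) :
    Solvable 3 (pull R) := by
  have hd : Disjoint ({F} : Finset (Fin N)) {G} := by simpa using hFG
  have hc : #({F} : Finset (Fin N)) = #({G} : Finset (Fin N)) := by simp
  have key : ∀ {f c o}, after R {F} {G} o f c → R f c ∧
      (o = .lt → f ≠ G ∧ (f = F ∨ c = F)) ∧ (o = .gt → f ≠ F ∧ (f = G ∨ c = G)) ∧
      (o = .eq → (f = F → c = G) ∧ (f = G → c = F)) := by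
    rintro f c o ⟨hfc, b, rfl⟩
    refine ⟨hfc, ?_⟩
    rw [outcome_of_card_eq hc]
    simp only [compare_lt_iff_lt, compare_gt_iff_gt, compare_eq_iff_eq, tilt, mem_singleton]
    by_cases h1 : f = F <;> by_cases h2 : f = G <;> by_cases h3 : c = F <;>
      by_cases h4 : c = G <;> cases b <;> simp_all
  refine Solvable.weigh_groups hd hc fun o => ?_
  cases o with
  | lt =>
    by_cases hF : R F F
    · refine Solvable.of_group (F := F) fun f c hfc => ?_
      obtain ⟨h1, h2, -, -⟩ := key hfc
      obtain ⟨-, h2⟩ := h2 rfl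
      by_contra hf
      rcases h2 with h2 | rfl
      · exact hf h2
      · exact hanti f _ hf h1 (hR _ hF f)
    · refine Solvable.of_two_groups (F := F) (G := H) (fun f c hfc => ?_) fun f hf => ?_
      · obtain ⟨h1, h2, -, -⟩ := key hfc
        have := h f c h1
        have := (h2 rfl).1
        tauto
      · have h1 := (key hf).1
        exact hF (hl f h1 ▸ h1)
  | gt =>
    refine Solvable.of_two_groups (F := G) (G := H) (fun f c hfc => ?_) fun f hf => ?_
    · obtain ⟨h1, -, h2, -⟩ := key hfc
      have := h f c h1
      have := (h2 rfl).1
      tauto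
    · obtain ⟨h1, -, h2, -⟩ := key hf
      exact (h2 rfl).1 (hl f h1)
  | eq =>
    have hlone : ∀ f, ¬ after R {F} {G} .eq f f := fun f hf => by
      obtain ⟨h1, -, -, h2⟩ := key hf
      have := hl f h1
      have := (h2 rfl).1 this
      exact hFG (by rw [← hl f h1, this])
    by_cases hRFG : R F G
    · refine Solvable.of_two_groups (F := F) (G := H) (fun f c hfc => ?_) hlone
      obtain ⟨h1, -, -, h2⟩ := key hfc
      have h3 := h f c h1
      by_cases hG : f = G
      · have := (h2 rfl).2 hG
        subst hG this
        exact absurd h1 (hanti _ _ hFG hRFG)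
      · tauto
    · refine Solvable.of_two_groups (F := G) (G := H) (fun f c hfc => ?_) hlone
      obtain ⟨h1, -, -, h2⟩ := key hfc
      have h3 := h f c h1
      by_cases hF : f = F
      · have := (h2 rfl).1 hF
        subst hF this
        exact absurd h1 hRFG
      · tauto

/-- Two arbitrary weighings can be replaced by three even ones: the case of an uneven first
weighing with many possible fakes. -/
lemma Resolves.solvable_of_odd {N : ℕ} (hN : 2 ≤ N) {R : Fin N → Fin N → Prop}
    (hR : LoneClosed R) (hanti : ∀ f c, f ≠ c → R f c → ¬ R c f) (hcard : 4 ≤ #(fakes R))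
    {A B : Finset (Fin (3 * N))} {ch : Ordering → FCTree (3 * N)}
    (h : Resolves (.weigh A B ch) (pull R)) (hd : (FCTree.weigh A B ch).depth ≤ 2)
    (hc : #A = #B + 1) : Solvable 3 (pull R) := by
  have hM : 2 ≤ 3 * N := by omega
  have hdisj : Disjoint A B := h.1.1
  have hch : ∀ o, (ch o).depth ≤ 1 := fun o => by
    have := FCTree.depth_child_lt hd o
    omega
  have hReq := hR.pull.after_eq hdisj hc
  have hRgt := hR.pull.after_gt hdisj hc
  have heq : #(fakes (after (pull R) A B .eq)) ≤ 6 := by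
    rcases (h.child .eq).card_fakes_le hM hReq (hch _) with h | ⟨h, -⟩ <;> omega
  have hgt : #(fakes (after (pull R) A B .gt)) ≤ 6 := by
    rcases (h.child .gt).card_fakes_le hM hRgt (hch _) with h | ⟨h, -⟩ <;> omega
  have hsum : 12 ≤ #(fakes (pull R) ∩ A) + #(fakes (pull R) \ A) := by
    rw [card_inter_add_card_sdiff, fakes_pull, card_expandPan]
    omega
  have hsubA : fakes (pull R) ∩ A ⊆ fakes (after (pull R) A B .eq) := by
    intro f hf
    obtain ⟨hf, hfA⟩ := mem_inter.1 hf
    obtain ⟨c, hfc⟩ := mem_fakes.1 hf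
    exact mem_fakes.2 ⟨c, (after_eq_iff hdisj hc).2 ⟨hfc, .inl hfA⟩⟩
  have hsubA' : fakes (pull R) \ A ⊆ fakes (after (pull R) A B .gt) := by
    intro f hf
    obtain ⟨hf, hfA⟩ := mem_sdiff.1 hf
    obtain ⟨c, hfc⟩ := mem_fakes.1 hf
    exact mem_fakes.2 ⟨c, (after_gt_iff hdisj hc).2 ⟨hfc, .inl hfA⟩⟩
  have h1 := card_le_card hsubA
  have h2 := card_le_card hsubA'
  have hA : fakes (pull R) ∩ A = fakes (after (pull R) A B .eq) :=
    eq_of_subset_of_card_le hsubA (by omega)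
  have hA' : fakes (pull R) \ A = fakes (after (pull R) A B .gt) :=
    eq_of_subset_of_card_le hsubA' (by omega)
  have hEA : ∀ {f c}, after (pull R) A B .eq f c → f ∈ A := fun {f c} hfc => by
    have := mem_fakes.2 ⟨c, hfc⟩
    rw [← hA] at this
    exact (mem_inter.1 this).2
  have hGA : ∀ {f c}, after (pull R) A B .gt f c → f ∉ A := fun {f c} hfc => by
    have := mem_fakes.2 ⟨c, hfc⟩
    rw [← hA'] at this
    exact (mem_sdiff.1 this).2
  have hlone : ∀ F, ¬ R F F := by
    intro F hF
    have hFF : ∀ i j, pull R (groupCoin F i) (groupCoin F j) := fun i j => by simpa [pull] using hF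
    have hne : ∀ i j : Fin 3, i ≠ j → groupCoin F i ≠ groupCoin F j :=
      fun i j hij h => hij (groupCoin_injective h).2
    have hside : ∀ i j, groupCoin F i ∈ A → groupCoin F j ∈ A := by
      intro i j hi
      by_contra hj
      by_cases hB : groupCoin F j ∈ B
      · exact hGA ((after_gt_iff hdisj hc).2 ⟨hFF i j, .inr hB⟩) hi
      · exact hj (hEA ((after_eq_iff hdisj hc).2 ⟨hFF j i, .inr ⟨hB, hi⟩⟩))
    by_cases h0 : groupCoin F 0 ∈ A
    · have hall : ∀ i j, after (pull R) A B .eq (groupCoin F i) (groupCoin F j) := fun i j =>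
        (after_eq_iff hdisj hc).2 ⟨hFF i j, .inl (hside 0 i h0)⟩
      exact (h.child .eq).not_three_pairs hM hReq (hch _) (by omega) (hne 0 1 (by decide))
        (hne 0 2 (by decide)) (hne 1 2 (by decide)) (hall _ _) (hall _ _) (hall _ _) (hall _ _)
    · have hall : ∀ i j, after (pull R) A B .gt (groupCoin F i) (groupCoin F j) := fun i j =>
        (after_gt_iff hdisj hc).2 ⟨hFF i j, .inl fun hi => h0 (hside i 0 hi)⟩
      exact (h.child .gt).not_three_pairs hM hRgt (hch _) (by omega) (hne 0 1 (by decide))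
        (hne 0 2 (by decide)) (hne 1 2 (by decide)) (hall _ _) (hall _ _) (hall _ _) (hall _ _)
  have hanti' : ∀ x y, pull R x y → ¬ pull R y x := by
    intro x y hxy hyx
    by_cases hg : coinGroup x = coinGroup y
    · exact hlone (coinGroup x) (by simpa [pull, ← hg] using hxy)
    · exact hanti _ _ hg hxy hyx
  obtain ⟨a, ha⟩ : A.Nonempty := card_pos.1 (by omega)
  refine Solvable.weigh (hdisj.mono_left (erase_subset a A)) ?_ fun o => ?_
  · rw [card_erase_of_mem ha, hc, Nat.add_sub_cancel]
  by_cases ho : o = .lt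
  · refine ((h.child .eq).solvable_of_depth_one hM hReq (hch _)).mono ?_ le_rfl
    rintro f c ⟨hfc, b, hb⟩
    rw [after_eq_iff hdisj hc]
    exact ⟨hfc, (outcome_erase hdisj hc ha).1 (hb.trans ho)⟩
  obtain hgt' | ⟨-, A', B', ch', hch', hc'⟩ := (h.child .gt).card_fakes_le hM hRgt (hch _)
  · omega
  have hres := h.child .gt
  have hdep := hch .gt
  rw [hch'] at hres hdep
  refine Solvable.weigh hres.1.1 hc' fun o' => ?_
  have hcard2 : #(fakes (after (after (pull R) A B .gt) A' B' o')) ≤ 2 :=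
    (hres.child o').card_fakes_le_two hM (hRgt.after_even hc' o')
      (by have := FCTree.depth_child_lt hdep o'; omega)
  obtain ⟨x, y, hxy⟩ := exists_subset_pair (by omega) hcard2
  rw [fakes_subset_iff] at hxy
  refine Solvable.of_triple_antisymm (x := x) (y := y) (z := a) ?_ (fun f hf => hlone _ hf.1.1)
    fun hx hy => hanti' x y hx.1.1 hy.1.1
  rintro f c ⟨⟨hfc, b, hb⟩, hb'⟩
  have h3 := (outcome_erase hdisj hc ha (f := f) (c := c) (b := b)).2 (by rwa [hb])
  by_cases hfa : f = a
  · exact .inr (.inr hfa)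
  · have := hxy f c ⟨(after_gt_iff hdisj hc).2 ⟨hfc, by tauto⟩, hb'⟩
    simp only [mem_insert, mem_singleton] at this
    tauto

/-- Two arbitrary weighings on a scaled problem can be replaced by three even ones. -/
lemma Resolves.solvable_groups_of_depth_two {N : ℕ} (hN : 2 ≤ N) {R : Fin N → Fin N → Prop}
    (hR : LoneClosed R) {t : FCTree (3 * N)} (h : Resolves t (pull R)) (hd : t.depth ≤ 2) :
    Solvable 3 (pull R) := by
  have hM : 2 ≤ 3 * N := by omega
  by_cases hcyc : ∃ F G, F ≠ G ∧ R F G ∧ R G F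
  · obtain ⟨F, G, hFG, h1, h2⟩ := hcyc
    obtain ⟨h3, h4⟩ := h.of_two_cycle hd hFG h1 h2
    exact (Solvable.of_two_groups h3 h4).mono (fun _ _ => id) (by simp)
  have hanti : ∀ f c, f ≠ c → R f c → ¬ R c f := fun f c hne h1 h2 => hcyc ⟨f, c, hne, h1, h2⟩
  by_cases hcard : 4 ≤ #(fakes R)
  · cases t with
    | output S =>
      have := h.card_fakes_le_two hM hR.pull (by simp [FCTree.depth])
      rw [fakes_pull, card_expandPan] at this
      omega
    | weigh A B ch =>
    wlog hAB : #B ≤ #A generalizing A B ch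
    · refine this B A _ h.swap ?_ (by omega)
      simp only [FCTree.depth] at hd ⊢
      simp only [Ordering.swap]
      omega
    have hch : ∀ o, (ch o).depth ≤ 1 := fun o => by
      have := FCTree.depth_child_lt hd o
      omega
    rcases (by omega : #A = #B ∨ #B + 2 ≤ #A ∨ #A = #B + 1) with hc | hc | hc
    · exact Solvable.weigh h.1.1 hc fun o =>
        (h.child o).solvable_of_depth_one hM (hR.pull.after_even hc o) (hch o)
    · have := h.child .gt
      rw [after_gt_of_card_add_two_le hc] at this
      exact (this.solvable_of_depth_one hM hR.pull (hch _)).mono (fun _ _ => id) (by simp)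
    · exact h.solvable_of_odd hN hR hanti hcard hd hc
  obtain ⟨F, hl, hF⟩ : ∃ F, (∀ f, R f f → f = F) ∧ #((fakes R).erase F) ≤ 2 := by
    by_cases hlone : ∃ F, R F F
    · obtain ⟨F, hF⟩ := hlone
      refine ⟨F, fun f hf => ?_, ?_⟩
      · by_contra hne
        exact hanti f F hne (hR f hf F) (hR F hF f)
      · rw [card_erase_of_mem (mem_fakes.2 ⟨F, hF⟩)]
        omega
    · push Not at hlone
      rcases (fakes R).eq_empty_or_nonempty with he | ⟨F, hF⟩
      · exact ⟨⟨0, by omega⟩, fun f hf => absurd hf (hlone f), by simp [he]⟩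
      · refine ⟨F, fun f hf => absurd hf (hlone f), ?_⟩
        rw [card_erase_of_mem hF]
        omega
  obtain ⟨x, y, hxy⟩ := exists_subset_pair (by omega) hF
  have hsub : ∀ f c, R f c → f = F ∨ f = x ∨ f = y := by
    intro f c hfc
    by_cases hf : f = F
    · exact .inl hf
    · have := hxy (mem_erase.2 ⟨hf, mem_fakes.2 ⟨c, hfc⟩⟩)
      simp only [mem_insert, mem_singleton] at this
      exact .inr this
  have : Nontrivial (Fin N) := Fin.nontrivial_iff_two_le.2 hN
  obtain ⟨z, hz⟩ := exists_ne F
  by_cases hx : x = F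
  · by_cases hy : y = F
    · exact Solvable.of_three_groups (H := F) hz.symm hR hanti (by grind) hl
    · exact Solvable.of_three_groups (H := x) (Ne.symm hy) hR hanti (by grind) hl
  · exact Solvable.of_three_groups (H := y) (Ne.symm hx) hR hanti hsub hl

lemma disjoint_of_expandPan {N : ℕ} {A B : Finset (Fin N)}
    (h : Disjoint (expandPan A) (expandPan B)) : Disjoint A B := by
  rw [Finset.disjoint_left] at *
  intro F hA hB
  exact h (a := groupCoin F 0) (by simpa using hA) (by simpa using hB)

section Scaling

variable {N : ℕ} {R : Fin N → Fin N → Prop} {ext : Finset (Fin N) → FCTree (3 * N)}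
  {A B : Finset (Fin N)} {ch : Ordering → FCTree N}

lemma Resolves.scaled_child (h : Resolves (scaleExtend ext (.weigh A B ch)) (pull R))
    (hc : #A = #B) (o : Ordering) : Resolves (scaleExtend ext (ch o)) (pull (after R A B o)) := by
  rw [← after_pull R hc]
  exact Resolves.child h o

/-- In the scaling, an uneven weighing of groups has only one possible outcome. -/
lemma Resolves.exists_scaled_child (h : Resolves (scaleExtend ext (.weigh A B ch)) (pull R))
    (hc : #A ≠ #B) : ∃ o, Resolves (scaleExtend ext (ch o)) (pull R) := by
  rcases lt_or_gt_of_ne hc with hlt | hlt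
  · have := (Resolves.swap h).child .gt
    rw [after_gt_of_card_add_two_le (by rw [card_expandPan, card_expandPan]; omega)] at this
    exact ⟨_, this⟩
  · have := Resolves.child h .gt
    rw [after_gt_of_card_add_two_le (by rw [card_expandPan, card_expandPan]; omega)] at this
    exact ⟨_, this⟩

/-- An extended scaling of any strategy can be made even at the cost of one weighing. -/
lemma Resolves.solvable_succ_of_scaled (hN : 2 ≤ N) (hext : ∀ S, (ext S).depth ≤ 2)
    (hR : LoneClosed R) {t : FCTree N} {n : ℕ} (hd : t.depth ≤ n)
    (h : Resolves (scaleExtend ext t) (pull R)) : Solvable (n + 3) (pull R) := by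
  induction t generalizing n R with
  | output S =>
    exact (h.solvable_groups_of_depth_two hN hR (hext S)).mono (fun _ _ => id) (by omega)
  | weigh A B ch ih =>
    obtain ⟨n, rfl⟩ : ∃ m, n = m + 1 := ⟨n - 1, by have := FCTree.depth_child_lt hd .lt; omega⟩
    have hch : ∀ o, (ch o).depth ≤ n := fun o => by
      have := FCTree.depth_child_lt hd o
      omega
    by_cases hc : #A = #B
    · rw [show n + 1 + 3 = n + 3 + 1 by omega]
      exact Solvable.weigh_groups (disjoint_of_expandPan h.1.1) hc fun o =>
        ih o (hR.after_even hc o) (hch o) (h.scaled_child hc o)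
    · obtain ⟨o, ho⟩ := h.exists_scaled_child hc
      exact (ih o hR (hch o) ho).mono (fun _ _ => id) (by omega)

/-- If `F` can be fake without a chameleon but `G` cannot be fake with chameleon `F`, then some
third coin is excluded as the chameleon for the fake `G`. -/
def ExclusionClosed (R : Fin N → Fin N → Prop) : Prop :=
  ∀ F G, R F F → G ≠ F → ¬ R G F → ∃ H, H ≠ F ∧ H ≠ G ∧ ¬ R G H

lemma sum_tilt {M : ℕ} (A B : Finset (Fin M)) : ∑ x, tilt A B x = #A - #B := by
  simp [tilt, Finset.sum_sub_distrib]

lemma exists_tilt_ne (hN : 4 ≤ N) (hc : #A = #B) {F G : Fin N} (hFG : G ≠ F)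
    (hF : tilt A B F = 0) (hG : tilt A B G ≠ 0) :
    ∃ H, H ≠ F ∧ H ≠ G ∧ tilt A B G + tilt A B H ≠ 0 := by
  by_contra! hall
  have hsum := sum_tilt A B
  rw [← add_sum_erase _ _ (mem_univ F), ← add_sum_erase _ _ (mem_erase.2 ⟨hFG, mem_univ G⟩),
    sum_congr rfl (g := fun _ => -tilt A B G), sum_const, card_erase_of_mem, card_erase_of_mem,
    card_univ, Fintype.card_fin, hF, hc, nsmul_eq_mul] at hsum
  · have h1 : tilt A B G * (1 - ((N - 1 - 1 : ℕ) : ℤ)) = 0 := by linarith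
    rcases mul_eq_zero.1 h1 with h2 | h2
    · exact hG h2
    · omega
  · simp
  · simp [hFG]
  · intro H hH
    simp only [mem_erase, mem_univ, and_true] at hH
    have := hall H hH.2 hH.1
    omega

lemma ExclusionClosed.after_even (hN : 4 ≤ N) (hR : ExclusionClosed R) (hc : #A = #B)
    (o : Ordering) : ExclusionClosed (after R A B o) := by
  rintro F G ⟨hF, b, hb⟩ hGF hG
  by_cases hRG : R G F
  swap
  · obtain ⟨H, h1, h2, h3⟩ := hR F G hF hGF hRG
    exact ⟨H, h1, h2, fun h => h3 h.1⟩
  have hne : ∀ b, outcome A B G F b ≠ o := fun b hb => hG ⟨hRG, b, hb⟩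
  rw [outcome_self hc] at hb
  subst hb
  have h0 := hne false
  have h1 := hne true
  simp only [outcome_of_card_eq hc, Bool.false_eq_true, if_false, if_true, add_zero] at h0 h1
  suffices ∃ H, H ≠ F ∧ H ≠ G ∧ compare 0 (tilt A B G + tilt A B H) ≠ compare 0 (tilt A B F) by
    obtain ⟨H, h2, h3, h4⟩ := this
    refine ⟨H, h2, h3, ?_⟩
    rintro ⟨-, b, hb⟩
    rw [outcome_of_card_eq hc] at hb
    cases b
    · exact h0 (by simpa using hb)
    · exact h4 (by simpa using hb)
  have hF1 := tilt_le A B F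
  have hF2 := neg_one_le_tilt A B F
  have hG1 := tilt_le A B G
  have hG2 := neg_one_le_tilt A B G
  rcases (by omega : tilt A B F = 0 ∨ tilt A B F = 1 ∨ tilt A B F = -1) with hF0 | hF0 | hF0
  · rw [hF0] at h0 ⊢
    obtain ⟨H, h2, h3, h4⟩ := exists_tilt_ne hN hc hGF hF0 (by intro h; simp [h] at h0)
    refine ⟨H, h2, h3, ?_⟩
    rw [Ne, show compare (0 : ℤ) 0 = .eq from rfl, compare_eq_iff_eq]
    exact fun h => h4 h.symm
  all_goals
    obtain ⟨H, hH⟩ : ∃ H, H ∉ ({F, G} : Finset (Fin N)) := by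
      by_contra! hall
      have := card_le_card (fun x _ => hall x : (univ : Finset (Fin N)) ⊆ {F, G})
      have := card_le_two (a := F) (b := G)
      simp at *
      omega
    simp only [mem_insert, mem_singleton, not_or] at hH
    refine ⟨H, hH.1, hH.2, ?_⟩
    have hH1 := tilt_le A B H
    have hH2 := neg_one_le_tilt A B H
    rw [hF0] at h0 h1 ⊢
  · rw [show compare (0 : ℤ) 1 = .lt from rfl, Ne, compare_lt_iff_lt] at *
    omega
  · rw [show compare (0 : ℤ) (-1) = .gt from rfl, Ne, compare_gt_iff_gt] at *
    omega

/-- An extended scaling of a valid strategy can be made even. -/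
lemma Resolves.solvable_of_scaled (hN : 2 ≤ N) (hN' : N ≠ 3) (hext : ∀ S, (ext S).depth ≤ 2)
    (hR : LoneClosed R) (hR' : 4 ≤ N → ExclusionClosed R) {t : FCTree N} {n : ℕ}
    (hd : t.depth ≤ n) (ht : Resolves t R) (h : Resolves (scaleExtend ext t) (pull R)) :
    Solvable (n + 2) (pull R) := by
  induction t generalizing n R with
  | output S =>
    refine Solvable.mono (n := 2) ?_ (fun _ _ => id) (by omega)
    have hcard := ht.card_fakes_le_two hN hR (by simp [FCTree.depth])
    by_cases hl : ∃ F, R F F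
    swap
    · obtain ⟨F, G, hFG⟩ := exists_subset_pair (by omega) hcard
      simp only [fakes_subset_iff, mem_insert, mem_singleton] at hFG
      exact Solvable.of_two_groups hFG fun f hf => hl ⟨f, hf⟩
    obtain ⟨F, hF⟩ := hl
    by_cases hG : ∀ f c, R f c → f = F
    · exact Solvable.of_group hG
    push Not at hG
    obtain ⟨G, c, hGc, hGF⟩ := hG
    have hsub : ∀ f c, R f c → f = F ∨ f = G := by
      have : ({F, G} : Finset (Fin N)) = fakes R := by
        refine eq_of_subset_of_card_le ?_ (by rwa [card_pair hGF.symm])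
        intro x hx
        simp only [mem_insert, mem_singleton] at hx
        rcases hx with rfl | rfl
        · exact mem_fakes.2 ⟨_, hF⟩
        · exact mem_fakes.2 ⟨c, hGc⟩
      intro f c hfc
      have hf := mem_fakes.2 ⟨c, hfc⟩
      rw [← this] at hf
      simpa using hf
    have h1 : ¬ R G F := fun hGF' => (h.of_two_cycle (hext S) hGF.symm (hR F hF G) hGF').2 F hF
    have h2 : ¬ R G G := fun hGG => h1 (hR G hGG F)
    have hN4 : 4 ≤ N := by
      have hcF : c ≠ F := by rintro rfl; exact h1 hGc
      have hcG : c ≠ G := by rintro rfl; exact h2 hGc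
      have := card_le_univ ({c, F, G} : Finset (Fin N))
      rw [card_eq_three.2 ⟨c, F, G, hcF, hcG, hGF.symm, rfl⟩, Fintype.card_fin] at this
      omega
    obtain ⟨H, h3, h4, h5⟩ := hR' hN4 F G hF hGF h1
    exact Solvable.of_two_groups_of_excluded hsub hGF.symm h3.symm h4.symm h1 h2 h5
  | weigh A B ch ih =>
    obtain ⟨n, rfl⟩ : ∃ m, n = m + 1 := ⟨n - 1, by have := FCTree.depth_child_lt hd .lt; omega⟩
    have hch : ∀ o, (ch o).depth ≤ n := fun o => by
      have := FCTree.depth_child_lt hd o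
      omega
    by_cases hc : #A = #B
    · rw [show n + 1 + 2 = n + 2 + 1 by omega]
      exact Solvable.weigh_groups ht.1.1 hc fun o =>
        ih o (hR.after_even hc o) (fun hN4 => (hR' hN4).after_even hN4 hc o) (hch o) (ht.child o)
          (h.scaled_child hc o)
    · obtain ⟨o, ho⟩ := h.exists_scaled_child hc
      exact ho.solvable_succ_of_scaled hN hext hR (hch o)

end Scaling

/-! ### Even strategies scale -/

/-- The placements for which the output `S` is correct. -/
def leafRel {N : ℕ} (S : Finset (Fin N)) (f c : Fin N) : Prop :=
  #S ≤ 2 ∧ f ∈ S ∧ (f = c → S = {f})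

lemma solvable_leafRel {N : ℕ} (S : Finset (Fin N)) : Solvable 2 (pull (leafRel S)) := by
  by_cases hl : ∃ F, leafRel S F F
  · obtain ⟨F, hF⟩ := hl
    have hS := hF.2.2 rfl
    exact Solvable.of_group (F := F) fun f c hfc => by simpa [hS] using hfc.2.1
  rcases S.eq_empty_or_nonempty with rfl | ⟨x, -⟩
  · refine (Solvable.of_card_fakes_le_two (le_of_eq_of_le ?_ (Nat.zero_le 2))).mono
      (fun _ _ => id) (by simp)
    rw [card_eq_zero, ← subset_empty, fakes_subset_iff]
    exact fun f c hfc => absurd hfc.2.1 (by simp)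
  · by_cases hS : #S ≤ 2
    · obtain ⟨F, G, hFG⟩ := exists_subset_pair (Fin.pos x) hS
      exact Solvable.of_two_groups (F := F) (G := G) (fun f c hfc => by simpa using hFG hfc.2.1)
        fun f hf => hl ⟨f, hf⟩
    · exact Solvable.of_group (F := x) fun f c hfc => absurd hfc.1 hS

/-- All placements of the fake and the chameleon, including those without a chameleon, are
resolved by even weighings. -/
def EvenSolvable (N n : ℕ) : Prop := Solvable n fun _ _ : Fin N => True

lemma FCTree.depth_scaleExtend_le {N m : ℕ} {ext : Finset (Fin N) → FCTree (3 * N)}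
    (hext : ∀ S, (ext S).depth ≤ m) (t : FCTree N) : (scaleExtend ext t).depth ≤ t.depth + m := by
  induction t with
  | output S => simpa [scaleExtend, depth] using hext S
  | weigh A B ch ih =>
    have h1 := ih .lt
    have h2 := ih .eq
    have h3 := ih .gt
    simp only [scaleExtend, depth]
    omega

lemma EvenPans.isFCSolution {N n : ℕ} {t : FCTree N} (ht : EvenPans t) (hd : t.depth ≤ n)
    (h : ∀ f c, Correct f c t) : IsFCSolution t n :=
  ⟨ht.wf, hd, fun f c hfc =>
    (Resolves.of_correct (R := fun _ _ => True) ht fun f c _ => h f c).2 f c trivial hfc⟩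

/-- An even strategy can be scaled, with an even extension that depends only on the outputs. -/
lemma EvenPans.exists_scaleExtend {N n : ℕ} {t : FCTree N} (ht : EvenPans t) (hd : t.depth ≤ n)
    (h : ∀ f c, Correct f c t) : ∃ ext : Finset (Fin N) → FCTree (3 * N),
      (∀ S, EvenPans (ext S) ∧ (ext S).depth ≤ 2) ∧ EvenPans (scaleExtend ext t) ∧
      (scaleExtend ext t).depth ≤ n + 2 ∧ ∀ x y, Correct x y (scaleExtend ext t) := by
  choose ext h1 h2 h3 using fun S : Finset (Fin N) => solvable_leafRel S
  refine ⟨ext, fun S => ⟨h1 S, h2 S⟩, ?_,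
    (FCTree.depth_scaleExtend_le h2 t).trans (Nat.add_le_add_right hd 2), fun x y => ?_⟩
  · clear hd h
    induction t with
    | output S => exact h1 S
    | weigh A B ch ih =>
      exact ⟨disjoint_expandPan ht.1, by rw [card_expandPan, card_expandPan, ht.2.1],
        fun o => ih o (ht.2.2 o)⟩
  · replace h := h (coinGroup x) (coinGroup y)
    clear hd
    induction t with
    | output S => exact h3 S x y h
    | weigh A B ch ih =>
      intro b
      rw [outcome_expandPan ht.2.1]
      exact ih _ (ht.2.2 _) (h b)

lemma EvenSolvable.exists_isScalable {N n : ℕ} (h : EvenSolvable N n) :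
    ∃ t : FCTree N, IsFCSolution t n ∧ IsScalable t n := by
  obtain ⟨t, h1, h2, h3⟩ := h
  replace h3 := fun f c => h3 f c trivial
  obtain ⟨ext, h4, h5, h6, h7⟩ := h1.exists_scaleExtend h2 h3
  exact ⟨t, h1.isFCSolution h2 h3, ext, fun S => ⟨(h4 S).1.wf, (h4 S).2⟩, h5.isFCSolution h6 h7⟩

lemma EvenSolvable.scale {N n : ℕ} (h : EvenSolvable N n) : EvenSolvable (3 * N) (n + 2) := by
  obtain ⟨t, h1, h2, h3⟩ := h
  obtain ⟨ext, -, h5, h6, h7⟩ := h1.exists_scaleExtend h2 fun f c => h3 f c trivial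
  exact ⟨_, h5, h6, fun x y _ => h7 x y⟩

lemma IsFCSolution.resolves {N n : ℕ} {t : FCTree N} (h : IsFCSolution t n) :
    Resolves t fun _ _ => True :=
  ⟨h.1, fun f c _ => h.2.2 f c⟩

/-- An FC-solution for `N` coins produces every pair of coins as an output. -/
lemma IsFCSolution.choose_two_le {N n : ℕ} {t : FCTree N} (h : IsFCSolution t n) :
    N.choose 2 ≤ 3 ^ n := by
  have : powersetCard 2 univ ⊆ t.outputs := by
    intro S hS
    obtain ⟨x, y, hxy, rfl⟩ := card_eq_two.1 (mem_powersetCard.1 hS).2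
    exact h.resolves.pair_mem_outputs hxy trivial trivial
  have := card_le_card this
  rw [card_powersetCard, card_univ, Fintype.card_fin] at this
  exact this.trans (FCTree.card_outputs_le h.2.1)

lemma IsScalable.evenSolvable {N w : ℕ} {t : FCTree N} (ht : IsFCSolution t w)
    (h : IsScalable t w) : EvenSolvable (3 * N) (w + 2) := by
  obtain ⟨ext, hext, hsol⟩ := h
  rcases (by omega : N = 0 ∨ N = 1 ∨ N = 3 ∨ (2 ≤ N ∧ N ≠ 3)) with rfl | rfl | rfl | ⟨hN, hN'⟩
  · exact ⟨.output ∅, trivial, by simp [FCTree.depth], fun f => f.elim0⟩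
  · exact (Solvable.of_group (R := fun _ _ => True) (F := (0 : Fin 1))
      fun f _ _ => Subsingleton.elim f 0).mono (fun _ _ => id) (by omega)
  · rcases Nat.lt_or_ge w 2 with hw | hw
    · have h1 := hsol.choose_two_le
      have h2 : (3 : ℕ) ^ (w + 2) ≤ 3 ^ 3 := Nat.pow_le_pow_right (by norm_num) (by omega)
      have h3 : (3 * 3).choose 2 = 36 := by decide
      omega
    · have h3 : EvenSolvable 3 2 := Solvable.of_triple (x := 0) (y := 1) (z := 2)
        fun f _ _ => by fin_cases f <;> simp
      exact h3.scale.mono (fun _ _ => id) (by omega)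
  · exact Resolves.solvable_of_scaled hN hN' (fun S => (hext S).2) (fun _ _ _ => trivial)
      (fun _ _ _ _ _ h => absurd trivial h) ht.2.1 ht.resolves hsol.resolves

lemma EvenSolvable.scale_pow {N n : ℕ} (h : EvenSolvable N n) (k : ℕ) :
    EvenSolvable (N * 3 ^ k) (n + 2 * k) := by
  induction k with
  | zero => simpa using h
  | succ k ih =>
    rw [show N * 3 ^ (k + 1) = 3 * (N * 3 ^ k) by ring, show n + 2 * (k + 1) = n + 2 * k + 2 by ring]
    exact ih.scale

end Scalability

/-- A scaling of a scalable (w,N)-solution produces a scalable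
(w+2,3N)-solution; consequently, if a scalable (w,N)-solution exists, then for
every integer k ≥ 0 a (w+2k, N·3^k)-solution exists. -/
theorem scaling_of_scalable_is_scalable (N w : ℕ) (t : FCTree N)
    (ht : IsFCSolution t w) (hscal : IsScalable t w) :
    (∃ t' : FCTree (3 * N), IsFCSolution t' (w + 2) ∧ IsScalable t' (w + 2)) ∧
    ∀ k : ℕ, ∃ t'' : FCTree (N * 3 ^ k), IsFCSolution t'' (w + 2 * k) := by
  have h := hscal.evenSolvable ht
  refine ⟨h.exists_isScalable, fun k => ?_⟩
  change FCAlgorithm (N * 3 ^ k) (w + 2 * k)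
  cases k with
  | zero =>
    rw [pow_zero, mul_one, mul_zero, add_zero]
    exact ⟨t, ht⟩
  | succ k =>
    obtain ⟨t', ht', -⟩ := (h.scale_pow k).exists_isScalable
    rw [show N * 3 ^ (k + 1) = 3 * N * 3 ^ k by ring,
      show w + 2 * (k + 1) = w + 2 + 2 * k by ring]
    exact ⟨t', ht'⟩
end
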